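/- (Proposition 5) Two triples {P, X_{V,W}, U} and {P̃, X̃_{Ṽ,W̃}, Ũ} are unitarily equivalent (i.e., there is a unitary Θ : H → H̃ with ΘPΘ* = P̃, ΘX_{V,W}Θ* = X̃_{Ṽ,W̃} and ΘUΘ* = Ũ) if and only if there exist unitary operators A₊ from K₊ onto K̃₊ and A₋ from K₋ onto K̃₋ such that A₊P₊ = P̃₊A₊, A₋P₋ = P̃₋A₋, A₊V = ṼA₋ and A₊W = W̃A₋. -/

import Mathlib

open MeasureTheory

noncomputable section

/-- The Hilbert sum `⊕_j L²(ν j)` of `L²`-spaces, as an `l²`-direct sum. -/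
abbrev HS {I : Type*} (ν : I → Measure ℝ) : Type _ := lp (fun j => Lp ℂ 2 (ν j)) 2

/-- The measure `t⁻¹ dμ₁` on `[q,1)`. -/
def wd (μ1 : Measure ℝ) : Measure ℝ := μ1.withDensity fun t => ENNReal.ofReal t⁻¹

/-- `μ` is the measure on `ℝ₊ = (0,∞)` induced by `μ₁` via `μ(qⁿM) = qⁿμ₁(M)`. -/
def IsInducedPlus (q : ℝ) (μ1 μ : Measure ℝ) : Prop :=
  μ (Set.Ioi (0 : ℝ))ᶜ = 0 ∧
  ∀ M : Set ℝ, MeasurableSet M → M ⊆ Set.Ico q 1 → ∀ n : ℤ,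
    μ ((fun t => q ^ n * t) '' M) = ENNReal.ofReal (q ^ n) * μ1 M

/-- `μ` is the measure on `ℝ₋ = (−∞,0)` induced by `μ₁` via `μ(−qⁿM) = qⁿμ₁(M)`. -/
def IsInducedMinus (q : ℝ) (μ1 μ : Measure ℝ) : Prop :=
  μ (Set.Iio (0 : ℝ))ᶜ = 0 ∧
  ∀ M : Set ℝ, MeasurableSet M → M ⊆ Set.Ico q 1 → ∀ n : ℤ,
    μ ((fun t => -(q ^ n * t)) '' M) = ENNReal.ofReal (q ^ n) * μ1 M

/-- `U` acts componentwise by `(Uf)(t) = q^{1/2} f(qt)`. -/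
def IsUop (q : ℝ) {I : Type*} (ν : I → Measure ℝ) (U : HS ν ≃ₗᵢ[ℂ] HS ν) : Prop :=
  ∀ f : HS ν, ∀ j : I, ∀ᵐ t ∂(ν j),
    ((U f : HS ν) j) t = ((q ^ ((1 : ℝ)/2) : ℝ) : ℂ) * ((f : HS ν) j) (q * t)

/-- `P` is the (maximal) multiplication operator `(Pf)(t) = t f(t)`, componentwise. -/
def IsPop {I : Type*} (ν : I → Measure ℝ) (P : HS ν →ₗ.[ℂ] HS ν) : Prop :=
  (∀ f : HS ν, f ∈ P.domain ↔
    ∃ g : HS ν, ∀ j : I, ∀ᵐ t ∂(ν j), (g j) t = (t : ℂ) * (f j) t) ∧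
  (∀ f : P.domain, ∀ j : I, ∀ᵐ t ∂(ν j),
    ((P f) j) t = (t : ℂ) * ((f : HS ν) j) t)

/-- `X` is the symmetric operator `(Xf)(t) = i t⁻¹(f(q⁻¹t) − f(qt))` on
`D(X) = {f : t⁻¹f ∈ H}`, componentwise. -/
def IsXop (q : ℝ) {I : Type*} (ν : I → Measure ℝ) (X : HS ν →ₗ.[ℂ] HS ν) : Prop :=
  (∀ f : HS ν, f ∈ X.domain ↔
    ∃ g : HS ν, ∀ j : I, ∀ᵐ t ∂(ν j), (g j) t = (t : ℂ)⁻¹ * (f j) t) ∧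
  (∀ f : X.domain, ∀ j : I, ∀ᵐ t ∂(ν j),
    ((X f) j) t = Complex.I * (t : ℂ)⁻¹ *
      (((f : HS ν) j) (q⁻¹ * t) - ((f : HS ν) j) (q * t)))

/-- `he` is the "even extension" `h^e` of `h : [q,1) → ℂ` to `ℝ₊`. -/
def IsEvenExt (q : ℝ) (h he : ℝ → ℂ) : Prop :=
  (∀ n : ℕ, ∀ t ∈ Set.Ico q 1, he (q ^ (2 * n) * t) = h t) ∧
  (∀ t : ℝ, (¬ ∃ n : ℕ, ∃ s ∈ Set.Ico q 1, t = q ^ (2 * n) * s) → he t = 0)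

/-- `ho` is the "odd extension" `h^o` of `h : [q,1) → ℂ` to `ℝ₊`. -/
def IsOddExt (q : ℝ) (h ho : ℝ → ℂ) : Prop :=
  (∀ n : ℕ, ∀ t ∈ Set.Ico q 1, ho (q ^ (2 * n + 1) * t) = h t) ∧
  (∀ t : ℝ, (¬ ∃ n : ℕ, ∃ s ∈ Set.Ico q 1, t = q ^ (2 * n + 1) * s) → ho t = 0)

/-- Even extension to the negative half-axis. -/
def IsEvenExtNeg (q : ℝ) (h he : ℝ → ℂ) : Prop :=
  (∀ n : ℕ, ∀ t ∈ Set.Ico q 1, he (-(q ^ (2 * n) * t)) = h t) ∧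
  (∀ t : ℝ, (¬ ∃ n : ℕ, ∃ s ∈ Set.Ico q 1, t = -(q ^ (2 * n) * s)) → he t = 0)

/-- Odd extension to the negative half-axis. -/
def IsOddExtNeg (q : ℝ) (h ho : ℝ → ℂ) : Prop :=
  (∀ n : ℕ, ∀ t ∈ Set.Ico q 1, ho (-(q ^ (2 * n + 1) * t)) = h t) ∧
  (∀ t : ℝ, (¬ ∃ n : ℕ, ∃ s ∈ Set.Ico q 1, t = -(q ^ (2 * n + 1) * s)) → ho t = 0)

/-- `(be, bo, ce, co) ∈ 𝕳₊ ⊕ 𝕳₊ ⊕ 𝕳₋ ⊕ 𝕳₋` are the boundary vectors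
`(𝔣_e^+, 𝔣_o^+, 𝔣_e^−, 𝔣_o^−)` of `𝔣 ∈ D(X*)` coming from the componentwise
decomposition `𝔣 = 𝔣_X + 𝔣^e + 𝔣^o` of Lemma 1. -/
def IsBdry (q : ℝ) {Ip Im : Type*} (μp : Ip → Measure ℝ) (μm : Im → Measure ℝ)
    (μ1p : Ip → Measure ℝ) (μ1m : Im → Measure ℝ)
    (X : HS (Sum.elim μp μm) →ₗ.[ℂ] HS (Sum.elim μp μm))
    (f : HS (Sum.elim μp μm))
    (be bo : HS (fun j => wd (μ1p j))) (ce co : HS (fun j => wd (μ1m j))) : Prop :=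
  f ∈ X.adjoint.domain ∧
  ∃ fX : HS (Sum.elim μp μm), fX ∈ X.domain ∧
    (∀ j : Ip, ∃ he ho : ℝ → ℂ,
      IsEvenExt q (⇑(be j)) he ∧ IsOddExt q (⇑(bo j)) ho ∧
      ∀ᵐ t ∂(μp j), (f (Sum.inl j)) t = (fX (Sum.inl j)) t + he t + ho t) ∧
    (∀ j : Im, ∃ he ho : ℝ → ℂ,
      IsEvenExtNeg q (⇑(ce j)) he ∧ IsOddExtNeg q (⇑(co j)) ho ∧
      ∀ᵐ t ∂(μm j), (f (Sum.inr j)) t = (fX (Sum.inr j)) t + he t + ho t)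

/-- Membership in the domain of `X_{V,W}`: `𝔣 ∈ D(X*)` whose boundary vectors satisfy
`𝔣_e^+ + 𝔣_o^+ = V(𝔣_e^− + 𝔣_o^−)` and `𝔣_e^+ − 𝔣_o^+ = W(𝔣_e^− − 𝔣_o^−)`. -/
def MemXVW (q : ℝ) {Ip Im : Type*} (μp : Ip → Measure ℝ) (μm : Im → Measure ℝ)
    (μ1p : Ip → Measure ℝ) (μ1m : Im → Measure ℝ)
    (X : HS (Sum.elim μp μm) →ₗ.[ℂ] HS (Sum.elim μp μm))
    (V W : HS (fun j => wd (μ1m j)) ≃ₗᵢ[ℂ] HS (fun j => wd (μ1p j)))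
    (f : HS (Sum.elim μp μm)) : Prop :=
  ∃ (be bo : HS (fun j => wd (μ1p j))) (ce co : HS (fun j => wd (μ1m j))),
    IsBdry q μp μm μ1p μ1m X f be bo ce co ∧
    be + bo = V (ce + co) ∧ be - bo = W (ce - co)

/-- The bounded operator `A` commutes with the (possibly unbounded) operator `T`,
i.e. `T A ⊆ A T`. -/
def CommutesPMap {H : Type*} [NormedAddCommGroup H] [InnerProductSpace ℂ H]
    (A : H →L[ℂ] H) (T : H →ₗ.[ℂ] H) : Prop :=
  ∀ f : T.domain, ∃ h : A f ∈ T.domain, T ⟨A f, h⟩ = A (T f)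

/-- `Θ T Θ* = T'` for a unitary `Θ` and (possibly unbounded) operators `T`, `T'`. -/
def TransportsPMap {H H' : Type*} [NormedAddCommGroup H] [InnerProductSpace ℂ H]
    [NormedAddCommGroup H'] [InnerProductSpace ℂ H']
    (Θ : H ≃ₗᵢ[ℂ] H') (T : H →ₗ.[ℂ] H) (T' : H' →ₗ.[ℂ] H') : Prop :=
  (∀ f : T.domain, ∃ h : Θ f ∈ T'.domain, T' ⟨Θ f, h⟩ = Θ (T f)) ∧
  (∀ g : T'.domain, Θ.symm g ∈ T.domain)


/-- `B : 𝕳 → 𝕳̃` is induced by `A : K → K̃` via the identification of the underlying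
functions (recall `𝕳` and `K` consist of the same functions, with different norms). -/
def InducedBdryMap {I I' : Type*} (μ1 : I → Measure ℝ) (μ1' : I' → Measure ℝ)
    (A : HS μ1 ≃ₗᵢ[ℂ] HS μ1')
    (B : HS (fun j => wd (μ1 j)) ≃ₗᵢ[ℂ] HS (fun j => wd (μ1' j))) : Prop :=
  ∀ (f : HS μ1) (g : HS (fun j => wd (μ1 j))),
    (∀ j : I, (⇑(g j) : ℝ → ℂ) =ᵐ[μ1 j] ⇑(f j)) →
    ∀ j : I', (⇑((B g) j) : ℝ → ℂ) =ᵐ[μ1' j] ⇑((A f) j)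

/-- `Pb` is the bounded multiplication operator `(P f)(t) = t f(t)` on `K = ⊕_j L²(μ1 j)`. -/
def IsMulCLM {I : Type*} (μ1 : I → Measure ℝ) (Pb : HS μ1 →L[ℂ] HS μ1) : Prop :=
  ∀ f : HS μ1, ∀ j : I, ∀ᵐ t ∂(μ1 j), ((Pb f) j) t = (t : ℂ) * (f j) t

section AbstractShift

lemma isometryEquiv_mul_apply {H : Type*} [NormedAddCommGroup H] [InnerProductSpace ℂ H]
    (U V : H ≃ₗᵢ[ℂ] H) (f : H) : (U * V) f = U (V f) := rfl

variable {H K H' K' : Type*}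
  [NormedAddCommGroup H'] [InnerProductSpace ℂ H'] [CompleteSpace H']
  [NormedAddCommGroup K'] [InnerProductSpace ℂ K'] [CompleteSpace K']
  [NormedAddCommGroup H] [InnerProductSpace ℂ H] [CompleteSpace H]
  [NormedAddCommGroup K] [InnerProductSpace ℂ K] [CompleteSpace K]

/-- `E` embeds `K` as a complete wandering subspace of the bilateral shift `U`. -/
structure Wandering (E : K →ₗᵢ[ℂ] H) (U : H ≃ₗᵢ[ℂ] H) : Prop where
  orthogonal : ∀ n : ℤ, n ≠ 0 → ∀ k l : K, inner ℂ (E k) ((U ^ n) (E l)) = 0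
  total : ∀ f : H, (∀ (n : ℤ) (k : K), inner ℂ (E k) ((U ^ n) f) = 0) → f = 0

/-- The `n`-th coefficient of a vector with respect to the bilateral shift `U`. -/
def coef (E : K →ₗᵢ[ℂ] H) (U : H ≃ₗᵢ[ℂ] H) (n : ℤ) : H →L[ℂ] K :=
  (ContinuousLinearMap.adjoint E.toContinuousLinearMap).comp
    ((U ^ n).toLinearIsometry.toContinuousLinearMap)

section Coef

variable {E : K →ₗᵢ[ℂ] H} {U : H ≃ₗᵢ[ℂ] H}

lemma inner_coef (n : ℤ) (k : K) (f : H) :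
    inner ℂ k (coef E U n f) = inner ℂ (E k) ((U ^ n) f) := by
  simp [coef, ContinuousLinearMap.adjoint_inner_right]

lemma norm_coef_le (n : ℤ) (f : H) : ‖coef E U n f‖ ≤ ‖f‖ := by
  calc ‖coef E U n f‖ ≤ ‖ContinuousLinearMap.adjoint E.toContinuousLinearMap‖ * ‖(U ^ n) f‖ :=
        (ContinuousLinearMap.adjoint E.toContinuousLinearMap).le_opNorm ((U ^ n) f)
    _ ≤ 1 * ‖(U ^ n) f‖ := by
        gcongr
        rw [LinearIsometryEquiv.norm_map]
        exact E.norm_toContinuousLinearMap_le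
    _ = ‖f‖ := by simp

omit [CompleteSpace H] in
lemma inner_zpow_apply (U : H ≃ₗᵢ[ℂ] H) (n : ℤ) (f g : H) :
    inner ℂ ((U ^ (-n)) f) g = inner ℂ f ((U ^ n) g) := by
  rw [← (U ^ n).inner_map_map, ← isometryEquiv_mul_apply, ← zpow_add]
  simp

lemma inner_zpow_embed (n : ℤ) (k : K) (f : H) :
    inner ℂ ((U ^ (-n)) (E k)) f = inner ℂ k (coef E U n f) := by
  rw [inner_coef, inner_zpow_apply]

lemma coef_zpow (n m : ℤ) (f : H) : coef E U n ((U ^ m) f) = coef E U (n + m) f := by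
  simp [coef, zpow_add]

lemma Wandering.coef_embed (h : Wandering E U) (n : ℤ) (k : K) :
    coef E U n (E k) = if n = 0 then k else 0 := by
  apply ext_inner_left ℂ
  intro l
  rw [inner_coef]
  split_ifs with hn
  · simp [hn]
  · simp [h.orthogonal n hn]

lemma Wandering.coef_zpow_embed (h : Wandering E U) (n m : ℤ) (k : K) :
    coef E U n ((U ^ (-m)) (E k)) = if n = m then k else 0 := by
  rw [coef_zpow, h.coef_embed]
  simp [← sub_eq_add_neg, sub_eq_zero]

lemma Wandering.coef_of_hasSum (h : Wandering E U) {w : ℤ → K} {x : H}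
    (hx : HasSum (fun m : ℤ => (U ^ (-m)) (E (w m))) x) (n : ℤ) : coef E U n x = w n := by
  refine (hx.mapL (coef E U n)).unique ?_
  convert hasSum_single (f := fun m : ℤ => coef E U n ((U ^ (-m)) (E (w m)))) n ?_ using 1
  · rw [h.coef_zpow_embed, if_pos rfl]
  · intro m hm
    rw [h.coef_zpow_embed, if_neg hm.symm]

lemma Wandering.ext (h : Wandering E U) {f g : H} (hfg : ∀ n, coef E U n f = coef E U n g) :
    f = g := by
  rw [← sub_eq_zero]
  refine h.total _ fun n k => ?_
  rw [map_sub, inner_sub_right, ← inner_coef, ← inner_coef, hfg, sub_self]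

lemma Wandering.isHilbertSum (h : Wandering E U) :
    IsHilbertSum ℂ (fun _ : ℤ => K) (fun n : ℤ => (U ^ (-n)).toLinearIsometry.comp E) := by
  refine IsHilbertSum.mk (fun n m hnm k l => ?_) ?_
  · change inner ℂ ((U ^ (-n)) (E k)) ((U ^ (-m)) (E l)) = 0
    rw [inner_zpow_embed, h.coef_zpow_embed, if_neg hnm, inner_zero_right]
  · rw [top_le_iff, Submodule.topologicalClosure_eq_top_iff, Submodule.eq_bot_iff]
    intro f hf
    refine h.total f fun n k => ?_
    rw [← inner_zpow_apply]
    exact hf _ (Submodule.mem_iSup_of_mem n ⟨k, rfl⟩)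

omit [CompleteSpace H] [CompleteSpace K] [CompleteSpace K'] in
lemma Wandering.comp (h : Wandering E U) (A : K' ≃ₗᵢ[ℂ] K) :
    Wandering (E.comp A.toLinearIsometry) U where
  orthogonal n hn k l := h.orthogonal n hn _ _
  total f hf := h.total f fun n k => by simpa using hf n (A.symm k)

end Coef

variable {E' : K' →ₗᵢ[ℂ] H'} {U' : H' ≃ₗᵢ[ℂ] H'} {E : K →ₗᵢ[ℂ] H} {U : H ≃ₗᵢ[ℂ] H}

/-- A unitary between wandering subspaces extends to a unitary intertwining the coefficients. -/
lemma Wandering.exists_extension (h : Wandering E U) (h' : Wandering E' U')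
    (A : K ≃ₗᵢ[ℂ] K') :
    ∃ Θ : H ≃ₗᵢ[ℂ] H', ∀ n f, coef E' U' n (Θ f) = A (coef E U n f) := by
  have h2 := (h'.comp A).isHilbertSum
  refine ⟨h.isHilbertSum.linearIsometryEquiv.trans h2.linearIsometryEquiv.symm, fun n f => ?_⟩
  obtain ⟨w, rfl⟩ := h.isHilbertSum.linearIsometryEquiv.symm.surjective f
  rw [LinearIsometryEquiv.trans_apply, LinearIsometryEquiv.apply_symm_apply,
    h.coef_of_hasSum (h.isHilbertSum.hasSum_linearIsometryEquiv_symm w),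
    h'.coef_of_hasSum (w := fun m => A (w m)) (h2.hasSum_linearIsometryEquiv_symm w)]

lemma Wandering.comm_of_coef (h' : Wandering E' U') {A : K → K'} {Θ : H → H'}
    (hΘ : ∀ n f, coef E' U' n (Θ f) = A (coef E U n f)) (f : H) : Θ (U f) = U' (Θ f) := by
  refine h'.ext fun n => ?_
  have h1 := coef_zpow (E := E) (U := U) n 1 f
  have h2 := coef_zpow (E := E') (U := U') n 1 (Θ f)
  rw [zpow_one] at h1 h2
  rw [hΘ, h1, h2, hΘ]

omit [CompleteSpace H] [CompleteSpace H'] in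
lemma zpow_comm_of_comm (Θ : H ≃ₗᵢ[ℂ] H') (hU : ∀ f, Θ (U f) = U' (Θ f)) (n : ℤ) (f : H) :
    Θ ((U ^ n) f) = (U' ^ n) (Θ f) := by
  have hU' : ∀ f, Θ (U⁻¹ f) = U'⁻¹ (Θ f) := by
    intro f
    apply U'.injective
    rw [← hU, ← isometryEquiv_mul_apply, ← isometryEquiv_mul_apply]
    simp
  induction n generalizing f with
  | zero => simp
  | succ n ih => simp only [zpow_add_one, isometryEquiv_mul_apply, ih, hU]
  | pred n ih => simp only [zpow_sub_one, isometryEquiv_mul_apply, ih, hU']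

lemma coef_of_comm (Θ : H ≃ₗᵢ[ℂ] H') (A : K ≃ₗᵢ[ℂ] K') (hU : ∀ f, Θ (U f) = U' (Θ f))
    (hE : ∀ k, Θ (E k) = E' (A k)) (n : ℤ) (f : H) :
    coef E' U' n (Θ f) = A (coef E U n f) := by
  apply ext_inner_left ℂ
  intro k
  obtain ⟨k, rfl⟩ := A.surjective k
  rw [inner_coef, A.inner_map_map, ← hE, ← zpow_comm_of_comm Θ hU, Θ.inner_map_map, inner_coef]

/-- The forward half of `Θ T Θ* = T'`, i.e. `Θ T ⊆ T' Θ`. -/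
def Carries (Θ : H ≃ₗᵢ[ℂ] H') (T : H →ₗ.[ℂ] H) (T' : H' →ₗ.[ℂ] H') : Prop :=
  ∀ f : T.domain, ∃ h : Θ f ∈ T'.domain, T' ⟨Θ f, h⟩ = Θ (T f)

/-- `P` acts on coefficients as `qⁿ D`, on its maximal domain. -/
def IsDiag (q : ℂ) (E : K →ₗᵢ[ℂ] H) (U : H ≃ₗᵢ[ℂ] H) (D : K →L[ℂ] K) (P : H →ₗ.[ℂ] H) : Prop :=
  (∀ f, f ∈ P.domain ↔ ∃ g, ∀ n, coef E U n g = q ^ n • D (coef E U n f)) ∧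
  ∀ (f : P.domain) (n : ℤ), coef E U n (P f) = q ^ n • D (coef E U n (f : H))

/-- `X` acts on coefficients as `i D⁻¹ q⁻ⁿ (p R_{n-1} - p⁻¹ R_{n+1})`, where `q = p²`,
on the range of `qⁿ D`. -/
def IsShiftDiff (p : ℂ) (E : K →ₗᵢ[ℂ] H) (U : H ≃ₗᵢ[ℂ] H) (D : K →L[ℂ] K)
    (X : H →ₗ.[ℂ] H) : Prop :=
  (∀ f, f ∈ X.domain ↔ ∃ g, ∀ n, coef E U n f = (p ^ 2) ^ n • D (coef E U n g)) ∧
  ∀ (f : X.domain) (n : ℤ), D (coef E U n (X f)) = (Complex.I * ((p ^ 2) ^ n)⁻¹) •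
    (p • coef E U (n - 1) (f : H) - p⁻¹ • coef E U (n + 1) (f : H))

variable {D : K →L[ℂ] K} {D' : K' →L[ℂ] K'} {Θ : H ≃ₗᵢ[ℂ] H'} {A : K ≃ₗᵢ[ℂ] K'}

lemma IsDiag.carries {q : ℂ} {P : H →ₗ.[ℂ] H} {P' : H' →ₗ.[ℂ] H'}
    (hP : IsDiag q E U D P) (hP' : IsDiag q E' U' D' P') (h' : Wandering E' U')
    (hΘ : ∀ n f, coef E' U' n (Θ f) = A (coef E U n f)) (hA : ∀ k, A (D k) = D' (A k)) :
    Carries Θ P P' := by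
  intro f
  have key : ∀ n, coef E' U' n (Θ (P f)) = q ^ n • D' (coef E' U' n (Θ f)) := by
    intro n
    rw [hΘ, hΘ, hP.2, map_smul, hA]
  have hmem : Θ f ∈ P'.domain := (hP'.1 _).2 ⟨_, key⟩
  refine ⟨hmem, h'.ext fun n => ?_⟩
  rw [hP'.2, key]

lemma IsShiftDiff.carries {p : ℂ} {X : H →ₗ.[ℂ] H} {X' : H' →ₗ.[ℂ] H'}
    (hX : IsShiftDiff p E U D X) (hX' : IsShiftDiff p E' U' D' X') (h' : Wandering E' U')
    (hD' : Function.Injective D')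
    (hΘ : ∀ n f, coef E' U' n (Θ f) = A (coef E U n f)) (hA : ∀ k, A (D k) = D' (A k)) :
    Carries Θ X X' := by
  intro f
  obtain ⟨g, hg⟩ := (hX.1 f).1 f.2
  have hmem : Θ f ∈ X'.domain := (hX'.1 _).2 ⟨Θ g, fun n => by
    rw [hΘ, hg, map_smul, hA, hΘ]⟩
  refine ⟨hmem, h'.ext fun n => hD' ?_⟩
  rw [hX'.2, hΘ n (X f), ← hA, hX.2]
  simp [hΘ]

lemma Carries.adjoint {T : H →ₗ.[ℂ] H} {T' : H' →ₗ.[ℂ] H'}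
    (h : Carries Θ T T') (hs : Carries Θ.symm T' T) : Carries Θ T.adjoint T'.adjoint := by
  intro f
  have hcont := (T.mem_adjoint_domain_iff (f : H)).1 f.2
  let τ : T'.domain → T.domain := fun x => ⟨Θ.symm x, (hs x).1⟩
  have hτ : Continuous τ := (Θ.symm.continuous.comp continuous_subtype_val).subtype_mk _
  have hval : ∀ x, inner ℂ (f : H) (T (τ x)) = inner ℂ (Θ f) (T' x) := by
    intro x
    rw [(hs x).2, ← Θ.inner_map_map, Θ.apply_symm_apply]
  have hmem : Θ f ∈ T'.adjoint.domain := by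
    rw [T'.mem_adjoint_domain_iff]
    refine (hcont.comp hτ).congr fun x => hval x
  refine ⟨hmem, ?_⟩
  by_cases hd : Dense (T.domain : Set H)
  · have hd' : Dense (T'.domain : Set H') := by
      refine (Θ.surjective.denseRange.dense_image Θ.continuous hd).mono ?_
      rintro _ ⟨x, hx, rfl⟩
      exact (h ⟨x, hx⟩).1
    refine LinearPMap.adjoint_apply_eq hd' _ fun x => ?_
    rw [← hval, ← LinearPMap.adjoint_isFormalAdjoint hd f (τ x), ← Θ.inner_map_map]
    simp [τ]
  · have hd' : ¬ Dense (T'.domain : Set H') := by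
      intro hd'
      refine hd ((Θ.symm.surjective.denseRange.dense_image Θ.symm.continuous hd').mono ?_)
      rintro _ ⟨x, hx, rfl⟩
      exact (hs ⟨x, hx⟩).1
    rw [LinearPMap.adjoint_apply_of_not_dense hd, LinearPMap.adjoint_apply_of_not_dense hd',
      map_zero]

/-- The weights `pⁿ` along `a, a + 2, a + 4, …`, and `0` elsewhere. -/
def altWeight (p : ℂ) (a n : ℤ) : ℂ := if a ≤ n ∧ Even (n - a) then p ^ n else 0

/-- `k` and `l` are the even and odd boundary vectors of `f`, expressed through coefficients. -/
def HasBdry (p : ℂ) (E : K →ₗᵢ[ℂ] H) (U : H ≃ₗᵢ[ℂ] H) (X : H →ₗ.[ℂ] H) (f : H) (k l : K) : Prop :=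
  ∃ g ∈ X.domain, ∀ n,
    coef E U n f = coef E U n g + altWeight p 0 n • k + altWeight p 1 n • l

lemma HasBdry.map {p : ℂ} {X : H →ₗ.[ℂ] H} {X' : H' →ₗ.[ℂ] H'} (hX : Carries Θ X X')
    (hΘ : ∀ n f, coef E' U' n (Θ f) = A (coef E U n f)) {f : H} {k l : K}
    (h : HasBdry p E U X f k l) : HasBdry p E' U' X' (Θ f) (A k) (A l) := by
  obtain ⟨g, hg, h⟩ := h
  refine ⟨Θ g, (hX ⟨g, hg⟩).1, fun n => ?_⟩
  rw [hΘ, hΘ, h]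
  simp

/-- A vector of the domain of `X` has no contribution growing like `pⁿ`. -/
lemma IsShiftDiff.tendsto_coef {p : ℝ} (hp0 : 0 < p) (hp1 : p < 1) {X : H →ₗ.[ℂ] H}
    (hX : IsShiftDiff (p : ℂ) E U D X) {f : H} (hf : f ∈ X.domain) (a : ℤ) :
    Filter.Tendsto (fun N : ℕ => ((p : ℂ) ^ (2 * (N : ℤ) + a))⁻¹ • coef E U (2 * N + a) f)
      Filter.atTop (nhds 0) := by
  obtain ⟨g, hg⟩ := (hX.1 f).1 hf
  have hp : (p : ℂ) ≠ 0 := by exact_mod_cast hp0.ne'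
  refine squeeze_zero_norm (a := fun N : ℕ => (p ^ 2) ^ N * (p ^ a * (‖D‖ * ‖g‖))) (fun N => ?_) ?_
  · rw [hg, smul_smul, norm_smul]
    have : ((p : ℂ) ^ (2 * (N : ℤ) + a))⁻¹ * ((p : ℂ) ^ 2) ^ (2 * (N : ℤ) + a) =
        (((p ^ 2) ^ N * p ^ a : ℝ) : ℂ) := by
      rw [sq, mul_zpow, inv_mul_cancel_left₀ (zpow_ne_zero _ hp), zpow_add₀ hp, zpow_mul]
      norm_cast
    rw [this, Complex.norm_real, Real.norm_of_nonneg (by positivity), mul_assoc]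
    gcongr
    exact (D.le_opNorm _).trans (by gcongr; exact norm_coef_le _ _)
  · simpa using (tendsto_pow_atTop_nhds_zero_of_lt_one (by positivity)
      (show p ^ 2 < 1 by nlinarith)).mul_const (p ^ a * (‖D‖ * ‖g‖))

lemma HasBdry.unique {p : ℝ} (hp0 : 0 < p) (hp1 : p < 1) {X : H →ₗ.[ℂ] H}
    (hX : IsShiftDiff (p : ℂ) E U D X) {f : H} {k l k' l' : K}
    (h : HasBdry (p : ℂ) E U X f k l) (h' : HasBdry (p : ℂ) E U X f k' l') : k = k' ∧ l = l' := by
  obtain ⟨g, hg, h⟩ := h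
  obtain ⟨g', hg', h'⟩ := h'
  have hp : (p : ℂ) ≠ 0 := by exact_mod_cast hp0.ne'
  have hmem := X.domain.sub_mem hg' hg
  have key : ∀ n, coef E U n (g' - g) =
      altWeight p 0 n • (k - k') + altWeight p 1 n • (l - l') := by
    intro n
    have := (h n).symm.trans (h' n)
    rw [map_sub]
    linear_combination (norm := module) (-1 : ℂ) • this
  constructor
  · have h0 := hX.tendsto_coef hp0 hp1 hmem 0
    rw [← sub_eq_zero]
    refine tendsto_nhds_unique (tendsto_const_nhds.congr fun N => ?_) h0
    rw [key]
    have h1 : ¬ Odd (2 * (N : ℤ)) := by simp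
    have h2 : (p : ℂ) ^ (2 * (N : ℤ)) ≠ 0 := zpow_ne_zero _ hp
    simp [altWeight, h1, h2, smul_smul]
  · have h0 := hX.tendsto_coef hp0 hp1 hmem 1
    rw [← sub_eq_zero]
    refine tendsto_nhds_unique (tendsto_const_nhds.congr fun N => ?_) h0
    rw [key]
    have h1 : ¬ Even (2 * (N : ℤ) + 1) := by simp
    have h2 : (p : ℂ) ^ (2 * (N : ℤ) + 1) ≠ 0 := zpow_ne_zero _ hp
    simp [altWeight, h1, h2, smul_smul]

lemma Wandering.exists_altWeight (h : Wandering E U) {p : ℝ} (hp0 : 0 < p) (hp1 : p < 1)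
    {X : H →ₗ.[ℂ] H} (hX : IsShiftDiff (p : ℂ) E U D X)
    (hsa : ∀ k l, inner ℂ (D k) l = inner ℂ k (D l)) (hsurj : Function.Surjective D)
    (a : ℤ) (k : K) :
    ∃ f ∈ X.adjoint.domain, ∀ n, coef E U n f = altWeight p a n • k := by
  have hp : (p : ℂ) ≠ 0 := by exact_mod_cast hp0.ne'
  let v : ℕ → H := fun m => (p : ℂ) ^ (2 * (m : ℤ) + a) • (U ^ (-(2 * (m : ℤ) + a))) (E k)
  have hv : Summable v := by
    refine Summable.of_norm_bounded (g := fun m : ℕ => (p ^ 2) ^ m * (p ^ a * ‖k‖))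
      ((summable_geometric_of_lt_one (by positivity) (by nlinarith)).mul_right _) fun m => ?_
    simp only [v, norm_smul, LinearIsometryEquiv.norm_map, LinearIsometry.norm_map, norm_zpow,
      Complex.norm_real, Real.norm_of_nonneg hp0.le]
    rw [zpow_add₀ hp0.ne', zpow_mul, mul_assoc]
    norm_cast
  refine ⟨∑' m, v m, ?_, fun n => ?_⟩
  · obtain ⟨k', rfl⟩ := hsurj k
    rw [LinearPMap.mem_adjoint_domain_iff]
    have hval : ∀ x : X.domain, inner ℂ (∑' m, v m) (X x) =
        inner ℂ k' ((Complex.I * ((p : ℂ) ^ (a - 1))⁻¹) • coef E U (a - 1) (x : H)) := by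
      intro x
      let T : ℕ → K := fun N =>
        ((p : ℂ) ^ (2 * (N : ℤ) + (a - 1)))⁻¹ • coef E U (2 * N + (a - 1)) (x : H)
      have hterm : ∀ m, inner ℂ (v m) (X x) = inner ℂ k' (Complex.I • (T m - T (m + 1))) := by
        intro m
        simp only [v, inner_smul_left, inner_zpow_embed, hsa, hX.2]
        have e1 : T m = ((p : ℂ) ^ (2 * (m : ℤ) + a - 1))⁻¹ •
            coef E U (2 * (m : ℤ) + a - 1) (x : H) := by
          simp only [T, ← add_sub_assoc]
        have e2 : T (m + 1) = ((p : ℂ) ^ (2 * (m : ℤ) + a + 1))⁻¹ •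
            coef E U (2 * (m : ℤ) + a + 1) (x : H) := by
          simp only [T, show 2 * ((m + 1 : ℕ) : ℤ) + (a - 1) = 2 * (m : ℤ) + a + 1 by
            push_cast; ring]
        rw [e1, e2]
        generalize 2 * (m : ℤ) + a = n
        rw [map_zpow₀, Complex.conj_ofReal, ← inner_smul_right, smul_sub, smul_sub, smul_sub]
        simp only [smul_smul]
        have hn : (p : ℂ) ^ n ≠ 0 := zpow_ne_zero _ hp
        have hq : ((p : ℂ) ^ 2) ^ n = (p : ℂ) ^ n * (p : ℂ) ^ n := by rw [sq, mul_zpow]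
        rw [hq, zpow_sub_one₀ hp, zpow_add_one₀ hp]
        congr 3 <;> field_simp
      have h1 : HasSum (fun m => inner ℂ (v m) (X x)) (inner ℂ (∑' m, v m) (X x)) := by
        have := (hv.hasSum.mapL (innerSL ℂ (X x))).star
        simpa using this
      refine tendsto_nhds_unique h1.tendsto_sum_nat ?_
      have hT := hX.tendsto_coef hp0 hp1 x.2 (a - 1)
      have h2 : ∀ N, ∑ m ∈ Finset.range N, inner ℂ (v m) (X x) =
          inner ℂ k' (Complex.I • (T 0 - T N)) := by
        intro N
        simp_rw [hterm]
        rw [← inner_sum, ← Finset.smul_sum, Finset.sum_range_sub']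
      simp_rw [h2]
      have h3 : Filter.Tendsto (fun N => inner ℂ k' (Complex.I • (T 0 - T N))) Filter.atTop
          (nhds (inner ℂ k' (Complex.I • (T 0 - 0)))) :=
        tendsto_const_nhds.inner ((tendsto_const_nhds.sub hT).const_smul _)
      convert h3 using 3
      simp [T, smul_smul]
    have hc : Continuous fun x : X.domain =>
        inner ℂ k' ((Complex.I * ((p : ℂ) ^ (a - 1))⁻¹) • coef E U (a - 1) (x : H)) := by
      fun_prop
    exact hc.congr fun x => (hval x).symm
  · have h1 := (hv.hasSum.mapL (coef E U n))
    refine h1.unique ?_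
    simp only [v, map_smul, h.coef_zpow_embed, altWeight]
    split_ifs with hn
    · obtain ⟨h2, m, hm⟩ := hn
      obtain ⟨m, rfl⟩ := Int.eq_ofNat_of_zero_le (show 0 ≤ m by omega)
      convert hasSum_single (f := fun j : ℕ => (p : ℂ) ^ (2 * (j : ℤ) + a) •
        (if n = 2 * (j : ℤ) + a then k else 0)) m ?_ using 1
      · rw [if_pos (by omega)]
        congr 2
        omega
      · intro j hj
        rw [if_neg (by omega), smul_zero]
    · rw [zero_smul]
      convert hasSum_zero with j
      rw [if_neg, smul_zero]
      rintro rfl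
      exact hn ⟨by omega, by simp⟩

lemma Wandering.exists_hasBdry (h : Wandering E U) {p : ℝ} (hp0 : 0 < p) (hp1 : p < 1)
    {X : H →ₗ.[ℂ] H} (hX : IsShiftDiff (p : ℂ) E U D X)
    (hsa : ∀ k l, inner ℂ (D k) l = inner ℂ k (D l)) (hsurj : Function.Surjective D) (k l : K) :
    ∃ f ∈ X.adjoint.domain, HasBdry p E U X f k l := by
  obtain ⟨f, hf, h1⟩ := h.exists_altWeight hp0 hp1 hX hsa hsurj 0 k
  obtain ⟨g, hg, h2⟩ := h.exists_altWeight hp0 hp1 hX hsa hsurj 1 l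
  exact ⟨f + g, X.adjoint.domain.add_mem hf hg, 0, X.domain.zero_mem, fun n => by
    simp [h1, h2]⟩

end AbstractShift
section HilbertSum

open scoped ENNReal NNReal

lemma hasSum_norm_sq {I : Type*} {G : I → Type*} [∀ i, NormedAddCommGroup (G i)] (f : lp G 2) :
    HasSum (fun i => ‖f i‖ ^ 2) (‖f‖ ^ 2) := by
  have := lp.hasSum_norm (p := 2) (by norm_num) f
  simpa using this

/-- The vector of a Hilbert sum with given square-summable components. -/
def mkHS {I : Type*} {ν : I → Measure ℝ} (f : ∀ i, Lp ℂ 2 (ν i))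
    (h : Summable fun i => ‖f i‖ ^ 2) : HS ν :=
  ⟨f, memℓp_gen (by simpa using h)⟩

lemma exists_hs_map {I : Type*} {ν ν' : I → Measure ℝ} (T : ∀ i, Lp ℂ 2 (ν i) →ₗ[ℂ] Lp ℂ 2 (ν' i))
    (C : ℝ≥0) (hC : ∀ i f, ‖T i f‖ ≤ C * ‖f‖) :
    ∃ S : HS ν →L[ℂ] HS ν', (∀ f i, (S f) i = T i (f i)) ∧ ∀ f, ‖S f‖ ≤ C * ‖f‖ := by
  have hle : ∀ (f : HS ν) i, ‖T i (f i)‖ ^ 2 ≤ C ^ 2 * ‖f i‖ ^ 2 := fun f i => by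
    rw [← mul_pow]
    gcongr
    exact hC i _
  have hs : ∀ f : HS ν, Summable fun i => ‖T i (f i)‖ ^ 2 := fun f =>
    Summable.of_nonneg_of_le (fun i => by positivity) (hle f)
      ((hasSum_norm_sq f).summable.mul_left _)
  let S : HS ν →ₗ[ℂ] HS ν' :=
    { toFun := fun f => mkHS (fun i => T i (f i)) (hs f)
      map_add' := fun f g => by
        ext1; funext i; exact map_add (T i) _ _
      map_smul' := fun c f => by
        ext1; funext i; exact map_smul (T i) _ _ }
  have hb : ∀ f, ‖S f‖ ≤ C * ‖f‖ := fun f => by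
    refine le_of_sq_le_sq ?_ (by positivity)
    rw [mul_pow]
    exact hasSum_le (hle f) (hasSum_norm_sq (S f)) ((hasSum_norm_sq f).mul_left _)
  exact ⟨S.mkContinuous C hb, fun f i => rfl, hb⟩

lemma hs_ext {I : Type*} {ν : I → Measure ℝ} {f g : HS ν}
    (h : ∀ i, ∀ᵐ t ∂ν i, (f i) t = (g i) t) : f = g := by
  ext1; funext i; exact Lp.ext (h i)

lemma hs_inner_congr {I : Type*} {ν : I → Measure ℝ} {f g : HS ν} {f' g' : HS ν}
    (h : ∀ i, ∀ᵐ t ∂ν i, inner ℂ ((f i) t) ((g i) t) = inner ℂ ((f' i) t) ((g' i) t)) :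
    inner ℂ f g = inner ℂ f' g' := by
  rw [lp.inner_eq_tsum, lp.inner_eq_tsum]
  refine tsum_congr fun i => ?_
  rw [L2.inner_def, L2.inner_def]
  exact integral_congr_ae (h i)

lemma hs_inner_eq_zero {I : Type*} {ν : I → Measure ℝ} {f g : HS ν}
    (h : ∀ i, ∀ᵐ t ∂ν i, (f i) t = 0 ∨ (g i) t = 0) : inner ℂ f g = 0 := by
  rw [lp.inner_eq_tsum]
  convert tsum_zero with i
  rw [L2.inner_def]
  refine integral_eq_zero_of_ae ?_
  filter_upwards [h i] with t ht
  rcases ht with ht | ht <;> simp [ht]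

/-- Weighted composition `f ↦ m · (f ∘ φ)` between `L²`-spaces. -/
lemma exists_weighted_comp {ν ν' : Measure ℝ} {m : ℝ → ℂ} {φ : ℝ → ℝ} (hm : Measurable m)
    (hφ : Measurable φ) (C : ℝ≥0)
    (hC : ∀ g : ℝ → ℝ≥0∞, Measurable g →
      ∫⁻ t, ‖m t‖ₑ ^ 2 * g (φ t) ∂ν' ≤ (C : ℝ≥0∞) ^ 2 * ∫⁻ t, g t ∂ν) :
    ∃ T : Lp ℂ 2 ν →ₗ[ℂ] Lp ℂ 2 ν', (∀ f, ∀ᵐ t ∂ν', (T f) t = m t * f (φ t)) ∧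
      ∀ f, ‖T f‖ ≤ C * ‖f‖ := by
  have hae : ∀ p : ℝ → Prop, (∀ᵐ t ∂ν, p t) → ∀ᵐ t ∂ν', m t ≠ 0 → p (φ t) := by
    intro p hp
    obtain ⟨Z, hZ, hZm, hZ0⟩ := exists_measurable_superset_of_null (show ν {t | ¬ p t} = 0 from hp)
    have h0 := hC (Z.indicator 1) (measurable_one.indicator hZm)
    rw [lintegral_indicator_one hZm, hZ0, mul_zero, nonpos_iff_eq_zero,
      lintegral_eq_zero_iff (by
        exact (hm.enorm.pow_const 2).mul ((measurable_one.indicator hZm).comp hφ))] at h0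
    filter_upwards [h0] with t ht hmt
    by_contra hpt
    have : φ t ∈ Z := hZ hpt
    simp [this, hmt] at ht
  have hnorm : ∀ f : Lp ℂ 2 ν, eLpNorm (fun t => m t * f (φ t)) 2 ν' ≤ C * eLpNorm f 2 ν := by
    intro f
    have hf := (Lp.stronglyMeasurable f).measurable
    have := hC (fun t => ‖f t‖ₑ ^ 2) (hf.enorm.pow_const 2)
    rw [← ENNReal.pow_le_pow_left_iff two_ne_zero, mul_pow]
    have e : ∀ (κ : Measure ℝ) (g : ℝ → ℂ), eLpNorm g 2 κ ^ 2 = ∫⁻ t, ‖g t‖ₑ ^ 2 ∂κ := by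
      intro κ g
      rw [eLpNorm_eq_lintegral_rpow_enorm_toReal (by norm_num) (by norm_num), ← ENNReal.rpow_natCast,
        ← ENNReal.rpow_mul]
      norm_num
    rw [e, e]
    refine le_trans (le_of_eq ?_) this
    refine lintegral_congr fun t => ?_
    rw [enorm_mul, mul_pow]
  have hmem : ∀ f : Lp ℂ 2 ν, MemLp (fun t => m t * f (φ t)) 2 ν' := fun f =>
    ⟨(hm.mul ((Lp.stronglyMeasurable f).measurable.comp hφ)).aestronglyMeasurable,
      (hnorm f).trans_lt (ENNReal.mul_lt_top ENNReal.coe_lt_top (Lp.eLpNorm_lt_top f))⟩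
  refine ⟨{ toFun := fun f => (hmem f).toLp _, map_add' := fun f g => ?_, map_smul' := fun c f => ?_ },
    fun f => (hmem f).coeFn_toLp, fun f => ?_⟩
  · apply Lp.ext
    filter_upwards [(hmem (f + g)).coeFn_toLp, (hmem f).coeFn_toLp, (hmem g).coeFn_toLp,
      Lp.coeFn_add ((hmem f).toLp _) ((hmem g).toLp _), hae _ (Lp.coeFn_add f g)]
      with t h1 h2 h3 h4 h5
    rw [h1, h4, Pi.add_apply, h2, h3]
    by_cases h : m t = 0
    · simp [h]
    · rw [h5 h, Pi.add_apply, mul_add]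
  · apply Lp.ext
    filter_upwards [(hmem (c • f)).coeFn_toLp, (hmem f).coeFn_toLp,
      Lp.coeFn_smul c ((hmem f).toLp _), hae _ (Lp.coeFn_smul c f)] with t h1 h2 h3 h4
    rw [h1, RingHom.id_apply, h3, Pi.smul_apply, h2]
    by_cases h : m t = 0
    · simp [h]
    · rw [h4 h, Pi.smul_apply, smul_eq_mul, smul_eq_mul]
      ring
  · change ‖(hmem f).toLp _‖ ≤ _
    rw [Lp.norm_toLp, Lp.norm_def, ← ENNReal.coe_toReal C, ← ENNReal.toReal_mul]
    exact ENNReal.toReal_mono (ENNReal.mul_lt_top ENNReal.coe_lt_top (Lp.eLpNorm_lt_top f)).ne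
      (hnorm f)

lemma exists_hs_weighted_comp {I : Type*} {ν ν' : I → Measure ℝ} {m : I → ℝ → ℂ} {φ : I → ℝ → ℝ}
    (hm : ∀ i, Measurable (m i)) (hφ : ∀ i, Measurable (φ i)) (C : ℝ≥0)
    (hC : ∀ i, ∀ g : ℝ → ℝ≥0∞, Measurable g →
      ∫⁻ t, ‖m i t‖ₑ ^ 2 * g (φ i t) ∂ν' i ≤ (C : ℝ≥0∞) ^ 2 * ∫⁻ t, g t ∂ν i) :
    ∃ T : HS ν →L[ℂ] HS ν', (∀ f i, ∀ᵐ t ∂ν' i, ((T f) i) t = m i t * (f i) (φ i t)) ∧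
      ∀ f, ‖T f‖ ≤ C * ‖f‖ := by
  choose T hT hTn using fun i => exists_weighted_comp (hm i) (hφ i) C (hC i)
  obtain ⟨S, hS, hSn⟩ := exists_hs_map T C hTn
  refine ⟨S, fun f i => ?_, hSn⟩
  rw [hS]
  exact hT i _

/-- Multiplication by a bounded function. -/
lemma exists_hs_mul {I : Type*} {ν : I → Measure ℝ} {m : I → ℝ → ℂ} (hm : ∀ i, Measurable (m i))
    (C : ℝ≥0) (hC : ∀ i, ∀ᵐ t ∂ν i, ‖m i t‖ ≤ C) :
    ∃ T : HS ν →L[ℂ] HS ν, (∀ f i, ∀ᵐ t ∂ν i, ((T f) i) t = m i t * (f i) t) ∧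
      ∀ f, ‖T f‖ ≤ C * ‖f‖ := by
  refine exists_hs_weighted_comp (φ := fun _ t => t) hm (fun _ => measurable_id) C
    fun i g hg => ?_
  rw [← lintegral_const_mul _ hg]
  refine lintegral_mono_ae ?_
  filter_upwards [hC i] with t ht
  gcongr
  rw [← ofReal_norm]
  exact ENNReal.ofReal_le_of_le_toReal (by simpa using ht)

end HilbertSum
section InducedMeasure

open scoped ENNReal NNReal

/-- `μ` is the measure on the half-axis of sign `σ` induced by the measure `μ₁` on `[q,1)`. -/
structure IsInduced (q σ : ℝ) (μ1 μ : Measure ℝ) : Prop where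
  pos : 0 < q
  lt_one : q < 1
  sign : σ = 1 ∨ σ = -1
  supp : μ1 (Set.Ico q 1)ᶜ = 0
  half : μ {t | ¬ 0 < σ * t} = 0
  scale : ∀ M : Set ℝ, MeasurableSet M → M ⊆ Set.Ico q 1 → ∀ n : ℤ,
    μ ((fun t => σ * (q ^ n * t)) '' M) = ENNReal.ofReal (q ^ n) * μ1 M

lemma IsInducedPlus.isInduced {q : ℝ} {μ1 μ : Measure ℝ} (h : IsInducedPlus q μ1 μ) (h0 : 0 < q)
    (h1 : q < 1) (hs : μ1 (Set.Ico q 1)ᶜ = 0) : IsInduced q 1 μ1 μ :=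
  ⟨h0, h1, Or.inl rfl, hs, by simpa [Set.compl_def] using h.1, by simpa using h.2⟩

lemma IsInducedMinus.isInduced {q : ℝ} {μ1 μ : Measure ℝ} (h : IsInducedMinus q μ1 μ) (h0 : 0 < q)
    (h1 : q < 1) (hs : μ1 (Set.Ico q 1)ᶜ = 0) : IsInduced q (-1) μ1 μ :=
  ⟨h0, h1, Or.inr rfl, hs, by simpa [Set.compl_def] using h.1, by simpa using h.2⟩

lemma exists_zpow_mul_eq {q x : ℝ} (h0 : 0 < q) (h1 : q < 1) (hx : 0 < x) :
    ∃ n : ℤ, ∃ s ∈ Set.Ico q 1, x = q ^ n * s := by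
  obtain ⟨n, hn1, hn2⟩ := exists_mem_Ioc_zpow (y := q⁻¹) (inv_pos.2 hx) ((one_lt_inv₀ h0).2 h1)
  have hq := h0.ne'
  have hp : 0 < q ^ n := zpow_pos h0 n
  rw [inv_zpow, inv_lt_inv₀ hp hx] at hn1
  rw [inv_zpow, inv_le_inv₀ hx (zpow_pos h0 _), zpow_add_one₀ hq] at hn2
  exact ⟨n, x / q ^ n, ⟨by rw [le_div_iff₀ hp]; linarith, by rw [div_lt_one hp]; exact hn1⟩,
    by field_simp⟩

lemma zpow_mul_injOn {q : ℝ} (h0 : 0 < q) (h1 : q < 1) {n m : ℤ} {s t : ℝ}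
    (hs : s ∈ Set.Ico q 1) (ht : t ∈ Set.Ico q 1) (h : q ^ n * s = q ^ m * t) : n = m := by
  have key : ∀ {n m : ℤ} {s t : ℝ}, s ∈ Set.Ico q 1 → t ∈ Set.Ico q 1 → q ^ n * s = q ^ m * t →
      ¬ n < m := by
    intro n m s t hs ht h hlt
    have h2 : q ^ m ≤ q ^ (n + 1) := zpow_le_zpow_right_of_le_one₀ h0 h1.le (by omega)
    have hp : 0 < q ^ n := zpow_pos h0 n
    have hm : 0 < q ^ m := zpow_pos h0 m
    rw [zpow_add_one₀ h0.ne'] at h2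
    have h3 : q ^ m * t < q ^ m := by nlinarith [ht.2]
    have h4 : q ^ n * q ≤ q ^ n * s := by nlinarith [hs.1]
    linarith
  rcases lt_trichotomy n m with h' | h' | h'
  · exact absurd h' (key hs ht h)
  · exact h'
  · exact absurd h' (key ht hs h.symm)

namespace IsInduced

variable {q σ : ℝ} {μ1 μ : Measure ℝ}

lemma sign_mul_self (h : IsInduced q σ μ1 μ) : σ * σ = 1 := by
  rcases h.sign with h | h <;> simp [h]

lemma sign_mul_mul (h : IsInduced q σ μ1 μ) (t : ℝ) : σ * (σ * t) = t := by
  rw [← mul_assoc, h.sign_mul_self, one_mul]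

lemma abs_sign (h : IsInduced q σ μ1 μ) : |σ| = 1 := by
  rcases h.sign with h | h <;> simp [h]

lemma ae_mem (h : IsInduced q σ μ1 μ) : ∀ᵐ s ∂μ1, s ∈ Set.Ico q 1 := h.supp

/-- A property holds almost everywhere on the half-axis iff it does on every dilate of `[q,1)`. -/
lemma ae_iff (h : IsInduced q σ μ1 μ) {p : ℝ → Prop} :
    (∀ᵐ t ∂μ, p t) ↔ ∀ n : ℤ, ∀ᵐ s ∂μ1, p (σ * (q ^ n * s)) := by
  have hqn : ∀ n : ℤ, ENNReal.ofReal (q ^ n) ≠ 0 := fun n => by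
    simpa using zpow_pos h.pos n
  constructor
  · intro hp n
    obtain ⟨Z, hZ, hZm, hZ0⟩ := exists_measurable_superset_of_null (show μ {t | ¬ p t} = 0 from hp)
    have hM := h.scale (Set.Ico q 1 ∩ (fun t => σ * (q ^ n * t)) ⁻¹' Z)
      (measurableSet_Ico.inter ((by fun_prop : Measurable fun t => σ * (q ^ n * t)) hZm))
      Set.inter_subset_left n
    have h0 : μ ((fun t => σ * (q ^ n * t)) ''
        (Set.Ico q 1 ∩ (fun t => σ * (q ^ n * t)) ⁻¹' Z)) = 0 :=
      measure_mono_null (by rintro _ ⟨s, hs, rfl⟩; exact hs.2) hZ0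
    rw [h0, eq_comm, mul_eq_zero, or_iff_right (hqn n)] at hM
    filter_upwards [h.ae_mem, measure_eq_zero_iff_ae_notMem.1 hM] with s hs hs'
    by_contra hps
    exact hs' ⟨hs, hZ hps⟩
  · intro hp
    choose Z hZ hZm hZ0 using fun n : ℤ => exists_measurable_superset_of_null
      (show μ1 {s | ¬ p (σ * (q ^ n * s))} = 0 from hp n)
    have h0 : ∀ n, μ ((fun t => σ * (q ^ n * t)) '' (Z n ∩ Set.Ico q 1)) = 0 := fun n => by
      rw [h.scale _ ((hZm n).inter measurableSet_Ico) Set.inter_subset_right,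
        measure_mono_null Set.inter_subset_left (hZ0 n), mul_zero]
    have h1 := measure_iUnion_null h0
    filter_upwards [show ∀ᵐ t ∂μ, 0 < σ * t from h.half, measure_eq_zero_iff_ae_notMem.1 h1]
      with t ht ht'
    by_contra hpt
    obtain ⟨n, s, hs, hts⟩ := exists_zpow_mul_eq h.pos h.lt_one ht
    have e : σ * (q ^ n * s) = t := by rw [← hts, h.sign_mul_mul]
    exact ht' (Set.mem_iUnion.2 ⟨n, s, ⟨hZ n (by rwa [Set.mem_ofPred_eq, e]), hs⟩, e⟩)

lemma ae_zpow_mul (h : IsInduced q σ μ1 μ) {p : ℝ → Prop} (hp : ∀ᵐ t ∂μ, p t) (m : ℤ) :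
    ∀ᵐ t ∂μ, p (q ^ m * t) := by
  rw [h.ae_iff] at hp ⊢
  intro n
  filter_upwards [hp (m + n)] with s hs
  rw [zpow_add₀ h.pos.ne'] at hs
  convert hs using 1
  ring

lemma ae_sign_mul (h : IsInduced q σ μ1 μ) {p : ℝ → Prop} (hp : ∀ᵐ t ∂μ, p t) :
    ∀ᵐ s ∂μ1, p (σ * s) := by
  simpa using h.ae_iff.1 hp 0

/-- The measure `μ₁` is the reflection of the restriction of `μ` to `σ[q,1)`. -/
lemma eq_map_restrict (h : IsInduced q σ μ1 μ) :
    μ1 = (μ.restrict {t | σ * t ∈ Set.Ico q 1}).map (fun t => σ * t) := by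
  have hm : Measurable fun t : ℝ => σ * t := by fun_prop
  ext S hS
  rw [Measure.map_apply hm hS, Measure.restrict_apply (hm hS)]
  have := h.scale (S ∩ Set.Ico q 1) (hS.inter measurableSet_Ico) Set.inter_subset_right 0
  simp only [zpow_zero, one_mul, ENNReal.ofReal_one] at this
  rw [← measure_inter_conull (t := Set.Ico q 1) h.supp, ← this]
  congr 1
  ext t
  constructor
  · rintro ⟨s, hs, rfl⟩
    simpa [h.sign_mul_mul] using hs
  · intro ht
    exact ⟨σ * t, ht, h.sign_mul_mul t⟩

lemma lintegral_eq (h : IsInduced q σ μ1 μ) {g : ℝ → ℝ≥0∞} (hg : Measurable g) :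
    ∫⁻ s, g s ∂μ1 = ∫⁻ t in {t | σ * t ∈ Set.Ico q 1}, g (σ * t) ∂μ := by
  conv_lhs => rw [h.eq_map_restrict]
  exact lintegral_map hg (by fun_prop)

end IsInduced

end InducedMeasure

section Model

open scoped ENNReal NNReal

lemma hs_coeFn_add {I : Type*} {ν : I → Measure ℝ} (f g : HS ν) (i : I) :
    ∀ᵐ t ∂ν i, ((f + g : HS ν) i) t = (f i) t + (g i) t := Lp.coeFn_add (f i) (g i)

lemma hs_coeFn_sub {I : Type*} {ν : I → Measure ℝ} (f g : HS ν) (i : I) :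
    ∀ᵐ t ∂ν i, ((f - g : HS ν) i) t = (f i) t - (g i) t := Lp.coeFn_sub (f i) (g i)

lemma hs_coeFn_smul {I : Type*} {ν : I → Measure ℝ} (c : ℂ) (f : HS ν) (i : I) :
    ∀ᵐ t ∂ν i, ((c • f : HS ν) i) t = c * (f i) t := Lp.coeFn_smul c (f i)

lemma hs_coeFn_zero {I : Type*} {ν : I → Measure ℝ} (i : I) :
    ∀ᵐ t ∂ν i, ((0 : HS ν) i) t = 0 := Lp.coeFn_zero ℂ 2 (ν i)

variable {I : Type*} {q : ℝ} {σ : I → ℝ} {μ1 μ : I → Measure ℝ}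

lemma ofReal_sqrt_ne_zero (hq : 0 < q) : ((√q : ℝ) : ℂ) ≠ 0 := by
  simpa using (Real.sqrt_pos.2 hq).ne'

lemma ofReal_sqrt_sq (hq : 0 < q) : ((√q : ℝ) : ℂ) ^ 2 = q := by
  rw [← Complex.ofReal_pow, Real.sq_sqrt hq.le]

lemma IsUop.zpow (h : ∀ i, IsInduced q (σ i) (μ1 i) (μ i)) {U : HS μ ≃ₗᵢ[ℂ] HS μ}
    (hU : IsUop q μ U) (n : ℤ) (f : HS μ) (i : I) :
    ∀ᵐ t ∂μ i, (((U ^ n) f : HS μ) i) t = ((√q : ℝ) : ℂ) ^ n * (f i) (q ^ n * t) := by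
  have hq := (h i).pos
  have hp := ofReal_sqrt_ne_zero hq
  have hU1 : ∀ f : HS μ, ∀ᵐ t ∂μ i, ((U f : HS μ) i) t = ((√q : ℝ) : ℂ) * (f i) (q * t) :=
    fun f => by
      rw [Real.sqrt_eq_rpow]
      exact hU f i
  induction n generalizing f with
  | zero => simp
  | succ n ih =>
    have e : (U ^ ((n : ℤ) + 1)) f = (U ^ (n : ℤ)) (U f) := by
      rw [zpow_add_one, isometryEquiv_mul_apply]
    rw [e]
    filter_upwards [ih (U f), (h i).ae_zpow_mul (hU1 f) n] with t h1 h2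
    rw [h1, h2, zpow_add_one₀ hp, zpow_add_one₀ hq.ne', mul_assoc, ← mul_assoc q, mul_comm q]
  | pred n ih =>
    have e : (U ^ (-(n : ℤ) - 1)) f = (U ^ (-(n : ℤ))) (U⁻¹ f) := by
      rw [zpow_sub_one, isometryEquiv_mul_apply]
    have e' : U (U⁻¹ f) = f := by rw [← isometryEquiv_mul_apply, mul_inv_cancel]; rfl
    rw [e]
    filter_upwards [ih (U⁻¹ f), (h i).ae_zpow_mul (hU1 (U⁻¹ f)) (-(n : ℤ) - 1)] with t h1 h2
    rw [e'] at h2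
    rw [h1, h2, zpow_sub_one₀ hp, zpow_sub_one₀ hq.ne']
    have : q * (q ^ (-(n : ℤ)) * q⁻¹ * t) = q ^ (-(n : ℤ)) * t := by
      field_simp
    rw [this]
    field_simp

/-- The concrete bilateral shift: `E` is extension by zero from `σ[q,1)`. -/
structure IsModel (q : ℝ) (σ : I → ℝ) (μ1 μ : I → Measure ℝ) (E : HS μ1 →ₗᵢ[ℂ] HS μ)
    (U : HS μ ≃ₗᵢ[ℂ] HS μ) : Prop where
  pos : 0 < q
  lt_one : q < 1
  induced : ∀ i, IsInduced q (σ i) (μ1 i) (μ i)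
  wandering : Wandering E U
  embed : ∀ k i, ∀ᵐ t ∂μ i,
    ((E k : HS μ) i) t = if σ i * t ∈ Set.Ico q 1 then (k i) (σ i * t) else 0
  coef_ae : ∀ n f i, ∀ᵐ s ∂μ1 i,
    ((coef E U n f : HS μ1) i) s = ((√q : ℝ) : ℂ) ^ n * (f i) (σ i * (q ^ n * s))

lemma exists_isModel (hq0 : 0 < q) (hq1 : q < 1) (h : ∀ i, IsInduced q (σ i) (μ1 i) (μ i))
    {U : HS μ ≃ₗᵢ[ℂ] HS μ} (hU : IsUop q μ U) : ∃ E, IsModel q σ μ1 μ E U := by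
  have hms : ∀ i, MeasurableSet {t | σ i * t ∈ Set.Ico q 1} := fun i =>
    measurableSet_Ico.preimage (by fun_prop : Measurable fun t : ℝ => σ i * t)
  obtain ⟨E, hE, hEn⟩ := exists_hs_weighted_comp (ν := μ1) (ν' := μ)
    (m := fun i => Set.indicator {t | σ i * t ∈ Set.Ico q 1} 1) (φ := fun i t => σ i * t)
    (fun i => measurable_one.indicator (hms i)) (fun i => by fun_prop) 1 (fun i g hg => by
      rw [(h i).lintegral_eq hg, ENNReal.coe_one, one_pow, one_mul, ← lintegral_indicator (hms i)]
      refine lintegral_mono fun t => ?_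
      by_cases ht : t ∈ {t | σ i * t ∈ Set.Ico q 1} <;> simp only [Set.indicator, ht] <;> simp)
  obtain ⟨R, hR, hRn⟩ := exists_hs_weighted_comp (ν := μ) (ν' := μ1)
    (m := fun i _ => 1) (φ := fun i t => σ i * t)
    (fun i => measurable_const) (fun i => by fun_prop) 1 (fun i g hg => by
      rw [(h i).lintegral_eq (g := fun t => ‖(1 : ℂ)‖ₑ ^ 2 * g (σ i * t))
        (by fun_prop), ENNReal.coe_one, one_pow, one_mul]
      simp only [(h i).sign_mul_mul, enorm_one, one_pow, one_mul]
      exact setLIntegral_le_lintegral _ _)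
  have hE' : ∀ k i, ∀ᵐ t ∂μ i,
      ((E k : HS μ) i) t = if σ i * t ∈ Set.Ico q 1 then (k i) (σ i * t) else 0 := fun k i => by
    filter_upwards [hE k i] with t ht
    rw [ht]
    by_cases h' : t ∈ {t | σ i * t ∈ Set.Ico q 1}
    · rw [Set.indicator_of_mem h', if_pos (show σ i * t ∈ Set.Ico q 1 from h'), Pi.one_apply, one_mul]
    · rw [Set.indicator_of_notMem h', if_neg (show ¬ σ i * t ∈ Set.Ico q 1 from h'), zero_mul]
  have hRE : ∀ k, R (E k) = k := fun k => by
    refine hs_ext fun i => ?_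
    filter_upwards [hR (E k) i, (h i).ae_sign_mul (hE' k i), (h i).ae_mem] with s h1 h2 h3
    rw [h1, h2, (h i).sign_mul_mul, if_pos h3, one_mul]
  have hEiso : ∀ k, ‖E k‖ = ‖k‖ := fun k => by
    refine le_antisymm (by simpa using hEn k) ?_
    calc ‖k‖ = ‖R (E k)‖ := by rw [hRE]
      _ ≤ ‖E k‖ := by simpa using hRn (E k)
  let E' : HS μ1 →ₗᵢ[ℂ] HS μ := ⟨E.toLinearMap, hEiso⟩
  have hEE' : ∀ k, E' k = E k := fun k => rfl
  have hER : ∀ f i, ∀ᵐ t ∂μ i,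
      ((E (R f) : HS μ) i) t = if σ i * t ∈ Set.Ico q 1 then (f i) t else 0 := fun f i => by
    have : ∀ᵐ t ∂μ i, σ i * t ∈ Set.Ico q 1 → ((R f) i) (σ i * t) = (f i) t := by
      rw [(h i).ae_iff]
      intro n
      by_cases hn : n = 0
      · filter_upwards [hR f i] with s hs
        simp [hn, (h i).sign_mul_mul, hs]
      · filter_upwards [(h i).ae_mem] with s hs hs'
        rw [(h i).sign_mul_mul] at hs'
        exact absurd (zpow_mul_injOn hq0 hq1 hs hs' (m := -n) (n := 0)
          (by rw [← mul_assoc, ← zpow_add₀ hq0.ne']; simp)) (by omega)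
    filter_upwards [this, hE' (R f) i] with t h1 h2
    rw [h2]
    split_ifs with h3
    · exact h1 h3
    · rfl
  have hadj : ∀ f, ContinuousLinearMap.adjoint E'.toContinuousLinearMap f = R f := fun f => by
    apply ext_inner_left ℂ
    intro k
    rw [ContinuousLinearMap.adjoint_inner_right]
    change inner ℂ (E' k) f = _
    rw [← E'.inner_map_map k (R f), hEE', hEE']
    refine hs_inner_congr fun i => ?_
    filter_upwards [hE' k i, hER f i] with t h1 h2
    rw [h1, h2]
    split_ifs <;> simp
  have hcoef : ∀ n f i, ∀ᵐ s ∂μ1 i,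
      ((coef E' U n f : HS μ1) i) s = ((√q : ℝ) : ℂ) ^ n * (f i) (σ i * (q ^ n * s)) := by
    intro n f i
    have e : coef E' U n f = R ((U ^ n) f) := hadj _
    rw [e]
    filter_upwards [hR ((U ^ n) f) i, (h i).ae_sign_mul (hU.zpow h n f i)] with s h1 h2
    rw [h1, h2, one_mul, mul_left_comm]
  refine ⟨E', hq0, hq1, h, ⟨fun n hn k l => ?_, fun f hf => ?_⟩, hE', hcoef⟩
  · refine hs_inner_eq_zero fun i => ?_
    filter_upwards [hE' k i, hU.zpow h n (E' l) i, (h i).ae_zpow_mul (hE' l i) n] with t h1 h2 h3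
    rw [hEE', h1]
    by_cases h4 : σ i * t ∈ Set.Ico q 1
    · right
      rw [h2, hEE', h3, if_neg, mul_zero]
      intro h5
      refine hn (zpow_mul_injOn hq0 hq1 h4 h5 (m := 0) ?_)
      simp only [zpow_zero, one_mul]
      ring
    · simp [h4]
  · refine hs_ext fun i => ?_
    have hc : ∀ n, coef E' U n f = 0 := fun n => by
      apply ext_inner_left ℂ
      intro k
      rw [inner_coef, hf, inner_zero_right]
    have : ∀ᵐ t ∂μ i, (f i) t = 0 := by
      rw [(h i).ae_iff]
      intro n
      have := hcoef n f i
      rw [hc] at this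
      filter_upwards [this, hs_coeFn_zero (ν := μ1) i] with s h1 h2
      rw [h2, eq_comm, mul_eq_zero] at h1
      exact h1.resolve_left (zpow_ne_zero _ (ofReal_sqrt_ne_zero hq0))
    filter_upwards [this, hs_coeFn_zero (ν := μ) i] with t h1 h2
    rw [h1, h2]

end Model

section ModelOperators

open scoped ENNReal NNReal

variable {I : Type*} {q : ℝ} {σ : I → ℝ} {μ1 μ : I → Measure ℝ}
  {E : HS μ1 →ₗᵢ[ℂ] HS μ} {U : HS μ ≃ₗᵢ[ℂ] HS μ} {D : HS μ1 →L[ℂ] HS μ1}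

/-- `D` is multiplication by `σ s` on `⊕ L²(μ₁)`. -/
def IsSignMul (σ : I → ℝ) (μ1 : I → Measure ℝ) (D : HS μ1 →L[ℂ] HS μ1) : Prop :=
  ∀ f i, ∀ᵐ s ∂μ1 i, ((D f : HS μ1) i) s = ((σ i * s : ℝ) : ℂ) * (f i) s

namespace IsModel

lemma ne_zero_ae (h : IsModel q σ μ1 μ E U) (i : I) : ∀ᵐ s ∂μ1 i, s ≠ 0 := by
  filter_upwards [(h.induced i).ae_mem] with s hs
  exact (h.pos.trans_le hs.1).ne'

lemma sign_ne_zero (h : IsModel q σ μ1 μ E U) (i : I) : σ i ≠ 0 := by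
  have := (h.induced i).sign_mul_self
  aesop

lemma exists_isSignMul (h : IsModel q σ μ1 μ E U) : ∃ D, IsSignMul σ μ1 D := by
  obtain ⟨D, hD, -⟩ := exists_hs_mul (ν := μ1) (m := fun i s => ((σ i * s : ℝ) : ℂ))
    (fun i => by fun_prop) 1 (fun i => by
      filter_upwards [(h.induced i).ae_mem] with s hs
      rw [Complex.norm_real, Real.norm_eq_abs, abs_mul, (h.induced i).abs_sign, one_mul,
        abs_of_nonneg (h.pos.le.trans hs.1)]
      exact hs.2.le)
  exact ⟨D, hD⟩

lemma signMul_inner (h : IsSignMul σ μ1 D) (k l : HS μ1) :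
    inner ℂ (D k) l = inner ℂ k (D l) := by
  refine hs_inner_congr fun i => ?_
  filter_upwards [h k i, h l i] with s h1 h2
  rw [h1, h2]
  simp
  ring

lemma signMul_injective (h : IsModel q σ μ1 μ E U) (hD : IsSignMul σ μ1 D) :
    Function.Injective D := by
  refine (injective_iff_map_eq_zero D).2 fun k hk => hs_ext fun i => ?_
  have := hD k i
  rw [hk] at this
  filter_upwards [this, hs_coeFn_zero (ν := μ1) i, h.ne_zero_ae i] with s h1 h2 h3
  rw [h2, eq_comm, mul_eq_zero, Complex.ofReal_eq_zero, mul_eq_zero] at h1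
  rw [h2]
  exact h1.resolve_left (not_or.2 ⟨h.sign_ne_zero i, h3⟩)

lemma signMul_surjective (h : IsModel q σ μ1 μ E U) (hD : IsSignMul σ μ1 D) :
    Function.Surjective D := by
  obtain ⟨T, hT, -⟩ := exists_hs_mul (ν := μ1) (m := fun i s => (((σ i * s)⁻¹ : ℝ) : ℂ))
    (fun i => by fun_prop) (Real.toNNReal q⁻¹) (fun i => by
      filter_upwards [(h.induced i).ae_mem] with s hs
      rw [Complex.norm_real, Real.norm_eq_abs, abs_inv, abs_mul, (h.induced i).abs_sign, one_mul,
        abs_of_nonneg (h.pos.le.trans hs.1), Real.coe_toNNReal _ (inv_pos.2 h.pos).le]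
      exact inv_anti₀ h.pos hs.1)
  refine fun k => ⟨T k, hs_ext fun i => ?_⟩
  filter_upwards [hD (T k) i, hT k i, h.ne_zero_ae i] with s h1 h2 h3
  rw [h1, h2, ← mul_assoc, ← Complex.ofReal_mul, mul_inv_cancel₀
    (mul_ne_zero (h.sign_ne_zero i) h3), Complex.ofReal_one, one_mul]

lemma mul_ae_iff_coef (h : IsModel q σ μ1 μ E U) (hD : IsSignMul σ μ1 D) {f g : HS μ} :
    (∀ i, ∀ᵐ t ∂μ i, (g i) t = (t : ℂ) * (f i) t) ↔
      ∀ n, coef E U n g = (q : ℂ) ^ n • D (coef E U n f) := by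
  have hp := ofReal_sqrt_ne_zero h.pos
  constructor
  · intro hfg n
    refine hs_ext fun i => ?_
    filter_upwards [h.coef_ae n g i, hs_coeFn_smul ((q : ℂ) ^ n) (D (coef E U n f)) i,
      hD (coef E U n f) i, h.coef_ae n f i, (h.induced i).ae_iff.1 (hfg i) n] with s h1 h2 h3 h4 h5
    rw [h1, h2, h3, h4, h5]
    push_cast
    ring
  · intro hc i
    rw [(h.induced i).ae_iff]
    intro n
    have := h.coef_ae n g i
    rw [hc] at this
    filter_upwards [this, hs_coeFn_smul ((q : ℂ) ^ n) (D (coef E U n f)) i,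
      hD (coef E U n f) i, h.coef_ae n f i] with s h1 h2 h3 h4
    rw [h2, h3, h4] at h1
    apply mul_left_cancel₀ (zpow_ne_zero n hp)
    rw [← h1]
    push_cast
    ring

lemma isDiag (h : IsModel q σ μ1 μ E U) (hD : IsSignMul σ μ1 D) {P : HS μ →ₗ.[ℂ] HS μ}
    (hP : IsPop μ P) : IsDiag (q : ℂ) E U D P :=
  ⟨fun f => (hP.1 f).trans (exists_congr fun _ => h.mul_ae_iff_coef hD),
    fun f => (h.mul_ae_iff_coef hD).1 (hP.2 f)⟩

lemma isShiftDiff (h : IsModel q σ μ1 μ E U) (hD : IsSignMul σ μ1 D) {X : HS μ →ₗ.[ℂ] HS μ}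
    (hX : IsXop q μ X) : IsShiftDiff ((√q : ℝ) : ℂ) E U D X := by
  have hp := ofReal_sqrt_ne_zero h.pos
  have hq : (q : ℂ) ≠ 0 := by exact_mod_cast h.pos.ne'
  rw [IsShiftDiff, ofReal_sqrt_sq h.pos]
  refine ⟨fun f => (hX.1 f).trans (exists_congr fun g => ?_), fun f n => hs_ext fun i => ?_⟩
  · rw [← h.mul_ae_iff_coef hD]
    refine forall_congr' fun i => Filter.eventually_congr ?_
    filter_upwards [show ∀ᵐ t ∂μ i, 0 < σ i * t from (h.induced i).half] with t ht
    have ht0 : (t : ℂ) ≠ 0 := by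
      rintro h0
      simp [Complex.ofReal_eq_zero.1 h0] at ht
    rw [eq_inv_mul_iff_mul_eq₀ ht0, eq_comm]
  · filter_upwards [hD (coef E U n (X f)) i, h.coef_ae n (X f) i,
      (h.induced i).ae_iff.1 (hX.2 f i) n, h.coef_ae (n - 1) (f : HS μ) i,
      h.coef_ae (n + 1) (f : HS μ) i, h.ne_zero_ae i,
      hs_coeFn_smul (Complex.I * ((q : ℂ) ^ n)⁻¹) (((√q : ℝ) : ℂ) • coef E U (n - 1) (f : HS μ) -
        ((√q : ℝ) : ℂ)⁻¹ • coef E U (n + 1) (f : HS μ)) i,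
      hs_coeFn_sub (((√q : ℝ) : ℂ) • coef E U (n - 1) (f : HS μ))
        (((√q : ℝ) : ℂ)⁻¹ • coef E U (n + 1) (f : HS μ)) i,
      hs_coeFn_smul ((√q : ℝ) : ℂ) (coef E U (n - 1) (f : HS μ)) i,
      hs_coeFn_smul ((√q : ℝ) : ℂ)⁻¹ (coef E U (n + 1) (f : HS μ)) i]
      with s h1 h2 h3 h4 h5 h6 h7 h8 h9 h10
    rw [h1, h2, h3, h7, h8, h9, h10, h4, h5]
    have e1 : q⁻¹ * (σ i * (q ^ n * s)) = σ i * (q ^ (n - 1) * s) := by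
      rw [zpow_sub_one₀ h.pos.ne']; ring
    have e2 : q * (σ i * (q ^ n * s)) = σ i * (q ^ (n + 1) * s) := by
      rw [zpow_add_one₀ h.pos.ne']; ring
    rw [e1, e2, zpow_sub_one₀ hp, zpow_add_one₀ hp]
    have hs : (σ i : ℂ) ≠ 0 := by exact_mod_cast h.sign_ne_zero i
    have h6' : (s : ℂ) ≠ 0 := by exact_mod_cast h6
    push_cast
    field_simp

end IsModel

/-- Extension of `h : [q,1) → ℂ` along the dilates `q^(2n+a)` on the half-axis of sign `σ`. -/
def IsAltExt (q σ : ℝ) (a : ℕ) (h he : ℝ → ℂ) : Prop :=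
  (∀ n : ℕ, ∀ t ∈ Set.Ico q 1, he (σ * (q ^ (2 * n + a) * t)) = h t) ∧
  ∀ t : ℝ, (¬ ∃ n : ℕ, ∃ s ∈ Set.Ico q 1, t = σ * (q ^ (2 * n + a) * s)) → he t = 0

lemma exists_isAltExt {σ : ℝ} (h0 : 0 < q) (h1 : q < 1) (hσ : σ ≠ 0) (a : ℕ) (h : ℝ → ℂ) :
    ∃ he, IsAltExt q σ a h he := by
  classical
  refine ⟨fun t => if H : ∃ s ∈ Set.Ico q 1, ∃ n : ℕ, t = σ * (q ^ (2 * n + a) * s) then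
    h H.choose else 0, fun n t ht => ?_, fun t ht => dif_neg fun ⟨s, hs, n, e⟩ => ht ⟨n, s, hs, e⟩⟩
  have H : ∃ s ∈ Set.Ico q 1, ∃ m : ℕ,
    σ * (q ^ (2 * n + a) * t) = σ * (q ^ (2 * m + a) * s) := ⟨t, ht, n, rfl⟩
  simp only
  rw [dif_pos H]
  obtain ⟨hs, m, e⟩ := H.choose_spec
  generalize H.choose = s at *
  have e' := mul_left_cancel₀ hσ e
  have := zpow_mul_injOn h0 h1 (n := (2 * n + a : ℕ)) (m := (2 * m + a : ℕ)) ht hs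
    (by simpa only [zpow_natCast] using e')
  rw [show 2 * n + a = 2 * m + a by exact_mod_cast this] at e'
  rw [mul_left_cancel₀ (pow_pos h0 _).ne' e']

lemma IsAltExt.apply {σ : ℝ} (h0 : 0 < q) (h1 : q < 1) (hσ : σ ≠ 0) {a : ℕ} {h he : ℝ → ℂ}
    (H : IsAltExt q σ a h he) (p : ℂ) (n : ℤ) {s : ℝ} (hs : s ∈ Set.Ico q 1) :
    p ^ n * he (σ * (q ^ n * s)) = altWeight p a n * h s := by
  rw [altWeight]
  split_ifs with hn
  · obtain ⟨m, hm⟩ : ∃ m : ℕ, n = (2 * m + a : ℕ) := by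
      obtain ⟨h1, k, h2⟩ := hn
      exact ⟨k.toNat, by omega⟩
    have := H.1 m s hs
    rw [hm, zpow_natCast, zpow_natCast, this]
  · rw [H.2, mul_zero, zero_mul]
    rintro ⟨m, t, ht, e⟩
    have e' := mul_left_cancel₀ hσ e
    rw [← zpow_natCast] at e'
    have := zpow_mul_injOn h0 h1 hs ht e'
    exact hn ⟨by omega, m, by omega⟩

lemma IsModel.hasBdry_iff (h : IsModel q σ μ1 μ E U) {X : HS μ →ₗ.[ℂ] HS μ} {f : HS μ}
    {k l : HS μ1} {b c : I → ℝ → ℂ} (hb : ∀ i, b i =ᵐ[μ1 i] k i) (hc : ∀ i, c i =ᵐ[μ1 i] l i) :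
    (∃ fX ∈ X.domain, ∀ i, ∃ he ho, IsAltExt q (σ i) 0 (b i) he ∧ IsAltExt q (σ i) 1 (c i) ho ∧
      ∀ᵐ t ∂μ i, (f i) t = (fX i) t + he t + ho t) ↔
    HasBdry ((√q : ℝ) : ℂ) E U X f k l := by
  have hp := ofReal_sqrt_ne_zero h.pos
  have key : ∀ (fX : HS μ) (n : ℤ) (i : I), ∀ᵐ s ∂μ1 i,
      ((coef E U n fX + altWeight ((√q : ℝ) : ℂ) 0 n • k + altWeight ((√q : ℝ) : ℂ) 1 n • l :
        HS μ1) i) s = ((√q : ℝ) : ℂ) ^ n * (fX i) (σ i * (q ^ n * s)) +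
          altWeight ((√q : ℝ) : ℂ) 0 n * b i s + altWeight ((√q : ℝ) : ℂ) 1 n * c i s := by
    intro fX n i
    filter_upwards [h.coef_ae n fX i, hs_coeFn_add
      (coef E U n fX + altWeight ((√q : ℝ) : ℂ) 0 n • k) (altWeight ((√q : ℝ) : ℂ) 1 n • l) i,
      hs_coeFn_add (coef E U n fX) (altWeight ((√q : ℝ) : ℂ) 0 n • k) i,
      hs_coeFn_smul (altWeight ((√q : ℝ) : ℂ) 0 n) k i,
      hs_coeFn_smul (altWeight ((√q : ℝ) : ℂ) 1 n) l i, hb i, hc i] with s h1 h2 h3 h4 h5 h6 h7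
    rw [h2, h3, h4, h5, h1, h6, h7]
  refine exists_congr fun fX => and_congr_right fun _ => ?_
  constructor
  · intro H n
    refine hs_ext fun i => ?_
    obtain ⟨he, ho, hhe, hho, hf⟩ := H i
    filter_upwards [key fX n i, h.coef_ae n f i, (h.induced i).ae_iff.1 hf n,
      (h.induced i).ae_mem] with s h1 h2 h3 hs
    rw [h1, h2, h3, mul_add, mul_add, hhe.apply h.pos h.lt_one (h.sign_ne_zero i) _ n hs,
      hho.apply h.pos h.lt_one (h.sign_ne_zero i) _ n hs]
    simp
  · intro H i
    obtain ⟨he, hhe⟩ := exists_isAltExt h.pos h.lt_one (h.sign_ne_zero i) 0 (b i)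
    obtain ⟨ho, hho⟩ := exists_isAltExt h.pos h.lt_one (h.sign_ne_zero i) 1 (c i)
    refine ⟨he, ho, hhe, hho, (h.induced i).ae_iff.2 fun n => ?_⟩
    have := h.coef_ae n f i
    rw [H n] at this
    filter_upwards [key fX n i, this, (h.induced i).ae_mem] with s h1 h2 hs
    apply mul_left_cancel₀ (zpow_ne_zero n hp)
    rw [← h2, h1, mul_add, mul_add, hhe.apply h.pos h.lt_one (h.sign_ne_zero i) _ n hs,
      hho.apply h.pos h.lt_one (h.sign_ne_zero i) _ n hs]
    simp

end ModelOperators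

section Support

open scoped ENNReal NNReal

/-- The components of `f` vanish almost everywhere outside `M`. -/
def SuppIn {I : Type*} {ν : I → Measure ℝ} (M : Set ℝ) (f : HS ν) : Prop :=
  ∀ i, ∀ᵐ t ∂ν i, t ∉ M → (f i) t = 0

variable {I J : Type*} {ν : I → Measure ℝ} {ν' : J → Measure ℝ} {P : HS ν →ₗ.[ℂ] HS ν}
  {P' : HS ν' →ₗ.[ℂ] HS ν'} {Θ : HS ν ≃ₗᵢ[ℂ] HS ν'} {c r d : ℝ} {M : Set ℝ} {f : HS ν}

/-- `f` admits all powers of `(P - c) / r`, with norms bounded by that of `f`. -/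
def PowerBounded {H : Type*} [NormedAddCommGroup H] [InnerProductSpace ℂ H]
    (P : H →ₗ.[ℂ] H) (c r : ℝ) (f : H) : Prop :=
  ∃ F : ℕ → H, F 0 = f ∧ (∀ n, ‖F n‖ ≤ ‖f‖) ∧
    ∀ n, ∃ h : F n ∈ P.domain, (r : ℂ) • F (n + 1) = P ⟨F n, h⟩ - (c : ℂ) • F n

lemma PowerBounded.map {H H' : Type*} [NormedAddCommGroup H] [InnerProductSpace ℂ H]
    [NormedAddCommGroup H'] [InnerProductSpace ℂ H'] {P : H →ₗ.[ℂ] H} {P' : H' →ₗ.[ℂ] H'}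
    {Θ : H ≃ₗᵢ[ℂ] H'} (hΘ : Carries Θ P P') {f : H} (h : PowerBounded P c r f) :
    PowerBounded P' c r (Θ f) := by
  obtain ⟨F, h0, hn, hF⟩ := h
  refine ⟨fun n => Θ (F n), congrArg Θ h0, by simpa using hn, fun n => ?_⟩
  obtain ⟨h, e⟩ := hF n
  obtain ⟨h', e'⟩ := hΘ ⟨F n, h⟩
  refine ⟨h', ?_⟩
  rw [e', ← map_smul, e, map_sub, map_smul]

lemma SuppIn.powerBounded (hP : IsPop ν P) (hr : 0 < r)
    (hf : SuppIn (Set.Icc (c - r) (c + r)) f) : PowerBounded P c r f := by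
  obtain ⟨T, hT, hTn⟩ := exists_hs_mul (ν := ν)
    (m := fun _ t => ((max (-1) (min 1 ((t - c) / r)) : ℝ) : ℂ)) (fun _ => by fun_prop) 1
    (fun _ => Filter.Eventually.of_forall fun t => by
      rw [Complex.norm_real, Real.norm_eq_abs, abs_le]
      exact ⟨le_max_left _ _, max_le (by norm_num) (min_le_left _ _)⟩)
  have hT1 : ∀ f, ‖T f‖ ≤ ‖f‖ := by simpa using hTn
  let F : ℕ → HS ν := fun n => (T ^ n) f
  have hF : ∀ n, F (n + 1) = T (F n) := fun n => by
    change (T ^ (n + 1)) f = _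
    rw [pow_succ']
    rfl
  have hsupp : ∀ n, SuppIn (Set.Icc (c - r) (c + r)) (F n) := by
    intro n
    induction n with
    | zero => exact hf
    | succ n ih =>
      rw [hF]
      intro i
      filter_upwards [ih i, hT (F n) i] with t h1 h2 h3
      rw [h2, h1 h3, mul_zero]
  have hmul : ∀ n i, ∀ᵐ t ∂ν i,
      (((r : ℂ) • F (n + 1) + (c : ℂ) • F n : HS ν) i) t = (t : ℂ) * ((F n) i) t := by
    intro n i
    filter_upwards [hs_coeFn_add ((r : ℂ) • F (n + 1)) ((c : ℂ) • F n) i,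
      hs_coeFn_smul (r : ℂ) (F (n + 1)) i, hs_coeFn_smul (c : ℂ) (F n) i, hT (F n) i,
      hsupp n i] with t h1 h2 h3 h4 h5
    rw [h1, h2, h3, hF, h4]
    by_cases ht : t ∈ Set.Icc (c - r) (c + r)
    · have e : max (-1) (min 1 ((t - c) / r)) = (t - c) / r := by
        rw [min_eq_right, max_eq_right]
        · rw [le_div_iff₀ hr]; linarith [ht.1]
        · rw [div_le_one hr]; linarith [ht.2]
      have hr' : (r : ℂ) ≠ 0 := by exact_mod_cast hr.ne'
      rw [e]
      push_cast
      field_simp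
      ring
    · simp [h5 ht]
  refine ⟨F, rfl, fun n => ?_, fun n => ?_⟩
  · induction n with
    | zero => rfl
    | succ n ih => rw [hF]; exact (hT1 _).trans ih
  · have hd : F n ∈ P.domain := (hP.1 _).2 ⟨_, hmul n⟩
    refine ⟨hd, eq_sub_of_add_eq (hs_ext fun i => ?_)⟩
    filter_upwards [hmul n i, hP.2 ⟨F n, hd⟩ i] with t h1 h2
    rw [h1, h2]

lemma PowerBounded.suppIn (hP : IsPop ν P) (hr : 0 < r) (h : PowerBounded P c r f) :
    SuppIn (Set.Icc (c - r) (c + r)) f := by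
  obtain ⟨F, h0, hn, hF⟩ := h
  have hr' : (r : ℂ) ≠ 0 := by exact_mod_cast hr.ne'
  intro i
  have hpow : ∀ n, ∀ᵐ t ∂ν i, ((F n) i) t = (((t - c) / r : ℝ) : ℂ) ^ n * (f i) t := by
    intro n
    induction n with
    | zero => simp [h0]
    | succ n ih =>
      obtain ⟨hd, e⟩ := hF n
      filter_upwards [ih, hP.2 ⟨F n, hd⟩ i, hs_coeFn_smul (r : ℂ) (F (n + 1)) i,
        hs_coeFn_sub (P ⟨F n, hd⟩) ((c : ℂ) • F n) i, hs_coeFn_smul (c : ℂ) (F n) i]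
        with t h1 h2 h3 h4 h5
      rw [e, h4, h2, h5, ← sub_mul, h1] at h3
      apply mul_left_cancel₀ hr'
      rw [← h3, pow_succ]
      push_cast
      field_simp
  have hbound : ∀ n, ∫⁻ t, ‖((F n) i) t‖ₑ ^ 2 ∂ν i ≤ ENNReal.ofReal ‖f‖ ^ 2 := by
    intro n
    have h1 : ‖(F n) i‖ ≤ ‖f‖ := (lp.norm_apply_le_norm two_ne_zero (F n) i).trans (hn n)
    have h2 : ∫⁻ t, ‖((F n) i) t‖ₑ ^ 2 ∂ν i = eLpNorm ((F n) i) 2 (ν i) ^ 2 := by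
      rw [eLpNorm_eq_lintegral_rpow_enorm_toReal (by norm_num) (by norm_num), ← ENNReal.rpow_natCast,
        ← ENNReal.rpow_mul]
      norm_num
    rw [h2]
    gcongr
    rw [← ENNReal.ofReal_toReal (Lp.eLpNorm_ne_top ((F n) i)), ← Lp.norm_def]
    exact ENNReal.ofReal_le_ofReal h1
  have hmeas : ∀ n, Measurable fun t => ‖((F n) i) t‖ₑ ^ 2 := fun n =>
    (Lp.stronglyMeasurable ((F n) i)).measurable.enorm.pow_const 2
  have hfatou : ∫⁻ t, Filter.liminf (fun n => ‖((F n) i) t‖ₑ ^ 2) Filter.atTop ∂ν i ≠ ∞ := by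
    refine ((lintegral_liminf_le hmeas).trans ?_).trans_lt
      (ENNReal.pow_lt_top (ENNReal.ofReal_lt_top (r := ‖f‖)) (n := 2)) |>.ne
    exact Filter.liminf_le_of_frequently_le' (Filter.Frequently.of_forall hbound)
  filter_upwards [ae_lt_top (Measurable.liminf hmeas) hfatou, ae_all_iff.2 hpow] with t h1 h2 ht
  by_contra hft
  refine h1.ne (Filter.Tendsto.liminf_eq ?_)
  have habs : 1 < |(t - c) / r| := by
    rw [abs_div, abs_of_pos hr, one_lt_div hr, lt_abs]
    by_contra! hcon
    exact ht ⟨by linarith, by linarith⟩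
  have h3 : Filter.Tendsto (fun n : ℕ => |(t - c) / r| ^ n * ‖(f i) t‖) Filter.atTop
      Filter.atTop :=
    (tendsto_pow_atTop_atTop_of_one_lt habs).atTop_mul_const (norm_pos_iff.2 hft)
  have h4 := ENNReal.Tendsto.pow (n := 2) (ENNReal.tendsto_ofReal_atTop.comp h3)
  rw [ENNReal.top_pow two_ne_zero] at h4
  refine h4.congr fun n => ?_
  rw [h2 n, Function.comp_apply, ← ofReal_norm, norm_mul, norm_pow, Complex.norm_real,
    Real.norm_eq_abs]

lemma suppIn_singleton_iff (hP : IsPop ν P) :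
    SuppIn {d} f ↔ ∃ h : f ∈ P.domain, P ⟨f, h⟩ = (d : ℂ) • f := by
  constructor
  · intro h
    have hm : ∀ i, ∀ᵐ t ∂ν i, (((d : ℂ) • f : HS ν) i) t = (t : ℂ) * (f i) t := fun i => by
      filter_upwards [h i, hs_coeFn_smul (d : ℂ) f i] with t h1 h2
      rw [h2]
      by_cases ht : t = d
      · rw [ht]
      · simp [h1 ht]
    have hd : f ∈ P.domain := (hP.1 f).2 ⟨_, hm⟩
    refine ⟨hd, hs_ext fun i => ?_⟩
    filter_upwards [hm i, hP.2 ⟨f, hd⟩ i] with t h1 h2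
    rw [h1, h2]
  · rintro ⟨hd, e⟩ i
    have := hP.2 ⟨f, hd⟩ i
    rw [e] at this
    filter_upwards [this, hs_coeFn_smul (d : ℂ) f i] with t h1 h2 ht
    rw [h2] at h1
    have h3 : ((d : ℂ) - t) * (f i) t = 0 := by rw [sub_mul, h1, sub_self]
    refine (mul_eq_zero.1 h3).resolve_left (sub_ne_zero.2 fun h4 => ht ?_)
    exact (Complex.ofReal_injective h4).symm

lemma suppIn_diff_singleton_iff :
    SuppIn (M \ {d}) f ↔ SuppIn M f ∧ ∀ g : HS ν, SuppIn {d} g → inner ℂ g f = 0 := by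
  constructor
  · refine fun h => ⟨fun i => ?_, fun g hg => hs_inner_eq_zero fun i => ?_⟩
    · filter_upwards [h i] with t h1 ht using h1 fun h2 => ht h2.1
    · filter_upwards [h i, hg i] with t h1 h2
      by_cases ht : t = d
      · exact Or.inr (h1 fun h3 => h3.2 ht)
      · exact Or.inl (h2 ht)
  · rintro ⟨h1, h2⟩ i
    obtain ⟨T, hT, -⟩ := exists_hs_mul (ν := ν) (m := fun _ => Set.indicator {d} 1)
      (fun _ => measurable_one.indicator (measurableSet_singleton d)) 1
      (fun _ => Filter.Eventually.of_forall fun t => by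
        by_cases ht : t ∈ ({d} : Set ℝ) <;> simp [ht])
    have h3 := h2 (T f) fun i => by
      filter_upwards [hT f i] with t ht htd
      rw [ht, Set.indicator_of_notMem htd, zero_mul]
    have h4 : inner ℂ (T f) f = inner ℂ (T f) (T f) := by
      refine hs_inner_congr fun i => ?_
      filter_upwards [hT f i] with t ht
      rw [ht]
      by_cases htd : t ∈ ({d} : Set ℝ) <;> simp [htd]
    rw [h4, inner_self_eq_zero] at h3
    have h5 := hT f i
    rw [h3] at h5
    filter_upwards [h1 i, h5, hs_coeFn_zero (ν := ν) i] with t h6 h7 h8 ht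
    by_cases htd : t = d
    · rw [h8, Set.indicator_of_mem (Set.mem_singleton_iff.2 htd), Pi.one_apply, one_mul] at h7
      exact h7.symm
    · exact h6 fun hM => ht ⟨hM, htd⟩

/-- An intertwiner of the position operators preserves supports in half-open intervals. -/
lemma SuppIn.map (hP : IsPop ν P) (hP' : IsPop ν' P') (hr : 0 < r) (hΘ : Carries Θ P P')
    (hΘ' : Carries Θ.symm P' P) (hf : SuppIn (Set.Icc (c - r) (c + r) \ {d}) f) :
    SuppIn (Set.Icc (c - r) (c + r) \ {d}) (Θ f) := by
  rw [suppIn_diff_singleton_iff] at hf ⊢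
  refine ⟨((hf.1.powerBounded hP hr).map hΘ).suppIn hP' hr, fun g hg => ?_⟩
  rw [suppIn_singleton_iff hP'] at hg
  obtain ⟨hd, e⟩ := hg
  obtain ⟨h1, h2⟩ := hΘ' ⟨g, hd⟩
  have := hf.2 (Θ.symm g) ((suppIn_singleton_iff hP).2 ⟨h1, by rw [h2, e, map_smul]⟩)
  rwa [← Θ.inner_map_map, Θ.apply_symm_apply] at this

lemma setOf_sign_mul_mem_Ico {q ε : ℝ} (hε : ε = 1 ∨ ε = -1) :
    {t : ℝ | ε * t ∈ Set.Ico q 1} =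
      Set.Icc (ε * ((1 + q) / 2) - (1 - q) / 2) (ε * ((1 + q) / 2) + (1 - q) / 2) \ {ε} := by
  ext t
  simp only [Set.mem_ofPred_eq, Set.mem_Ico, Set.mem_sdiff, Set.mem_Icc, Set.mem_singleton_iff]
  rcases hε with rfl | rfl
  · constructor
    · rintro ⟨h1, h2⟩
      exact ⟨⟨by linarith, by linarith⟩, by linarith⟩
    · rintro ⟨⟨h1, h2⟩, h3⟩
      exact ⟨by linarith, lt_of_le_of_ne (by linarith) (by simpa using h3)⟩
  · constructor
    · rintro ⟨h1, h2⟩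
      exact ⟨⟨by linarith, by linarith⟩, by linarith⟩
    · rintro ⟨⟨h1, h2⟩, h3⟩
      exact ⟨by linarith, lt_of_le_of_ne (by linarith) fun h => h3 (by linarith)⟩

variable {q : ℝ} {σ : I → ℝ} {μ1 μ : I → Measure ℝ} {E : HS μ1 →ₗᵢ[ℂ] HS μ}
  {U : HS μ ≃ₗᵢ[ℂ] HS μ}

lemma IsModel.suppIn_embed (h : IsModel q σ μ1 μ E U) {ε : ℝ} {k : HS μ1}
    (hk : ∀ i, σ i ≠ ε → k i = 0) : SuppIn {t | ε * t ∈ Set.Ico q 1} (E k) := by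
  intro i
  by_cases hi : σ i = ε
  · filter_upwards [h.embed k i] with t h1 ht
    rw [h1, hi]
    exact if_neg ht
  · have h0 : ∀ᵐ s ∂μ1 i, (k i) s = 0 := by
      rw [hk i hi]
      exact Lp.coeFn_zero ℂ 2 (μ1 i)
    rw [(h.induced i).ae_iff]
    intro n
    filter_upwards [(h.induced i).ae_iff.1 (h.embed k i) n, h0, (h.induced i).ae_mem]
      with s h1 h2 h3 _
    rw [h1, (h.induced i).sign_mul_mul]
    split_ifs with h4
    · have := zpow_mul_injOn h.pos h.lt_one (n := n) (m := 0) h3 h4 (by simp)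
      simpa [this] using h2
    · rfl

lemma IsModel.exists_of_suppIn (h : IsModel q σ μ1 μ E U) {ε : ℝ} {f : HS μ}
    (hε : ε = 1 ∨ ε = -1)
    (hf : SuppIn {t | ε * t ∈ Set.Ico q 1} f) : ∃ k, (∀ i, σ i ≠ ε → k i = 0) ∧ E k = f := by
  refine ⟨coef E U 0 f, fun i hi => ?_, h.wandering.ext fun n => ?_⟩
  · have hσ : σ i = - ε := by
      rcases (h.induced i).sign with h1 | h1 <;> rcases hε with h2 | h2 <;> simp_all
    have hεε : ε * ε = 1 := by rcases hε with h2 | h2 <;> simp [h2]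
    apply Lp.ext
    filter_upwards [h.coef_ae 0 f i, (h.induced i).ae_sign_mul (hf i), (h.induced i).ae_mem,
      Lp.coeFn_zero ℂ 2 (μ1 i)] with s h1 h2 h3 h4
    rw [h1, h4, zpow_zero, zpow_zero, one_mul, one_mul, Pi.zero_apply]
    refine h2 fun h5 => ?_
    have h5 : q ≤ ε * (σ i * s) := h5.1
    rw [hσ, neg_mul, mul_neg, ← mul_assoc, hεε, one_mul] at h5
    linarith [h.pos, h3.1]
  · rw [h.wandering.coef_embed]
    split_ifs with hn
    · rw [hn]
    · refine (hs_ext fun i => ?_).symm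
      filter_upwards [h.coef_ae n f i, (h.induced i).ae_iff.1 (hf i) n, (h.induced i).ae_mem,
        hs_coeFn_zero (ν := μ1) i] with s h1 h2 h3 h4
      rw [h1, h4, h2, mul_zero]
      intro h5
      have h5 : ε * (σ i * (q ^ n * s)) ∈ Set.Ico q 1 := h5
      have hpos := mul_pos (zpow_pos h.pos n) (h.pos.trans_le h3.1)
      have hε : ε * σ i = 1 := by
        have := h.pos.trans_le h5.1
        rcases (h.induced i).sign with h1 | h1 <;> rcases hε with h2 | h2 <;> simp_all <;> linarith
      rw [← mul_assoc, hε, one_mul] at h5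
      exact hn (zpow_mul_injOn h.pos h.lt_one (n := n) (m := 0) h3 h5 (by simp))

/-- An intertwiner of the position operators maps each signed part of the wandering subspace
into the corresponding one. -/
lemma IsModel.exists_map_embed {q : ℝ} {σ' : J → ℝ} {ν1' : J → Measure ℝ}
    {E' : HS ν1' →ₗᵢ[ℂ] HS ν'} {U' : HS ν' ≃ₗᵢ[ℂ] HS ν'} {ν1 : I → Measure ℝ}
    {E : HS ν1 →ₗᵢ[ℂ] HS ν} {U : HS ν ≃ₗᵢ[ℂ] HS ν}
    (h : IsModel q σ ν1 ν E U) (h' : IsModel q σ' ν1' ν' E' U')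
    (hP : IsPop ν P) (hP' : IsPop ν' P') (hΘ : Carries Θ P P')
    (hΘ' : Carries Θ.symm P' P) {ε : ℝ} (hε : ε = 1 ∨ ε = -1) {k : HS ν1}
    (hk : ∀ i, σ i ≠ ε → k i = 0) : ∃ k', (∀ i, σ' i ≠ ε → k' i = 0) ∧ E' k' = Θ (E k) := by
  refine h'.exists_of_suppIn hε ?_
  have := h.suppIn_embed hk
  rw [setOf_sign_mul_mem_Ico hε] at this ⊢
  exact this.map hP hP' (by linarith [h.lt_one]) hΘ hΘ'

end Support

section SumSplitting

variable {I J I' J' : Type*} {a' : I' → Measure ℝ} {b' : J' → Measure ℝ} {a : I → Measure ℝ}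
  {b : J → Measure ℝ}

/-- The components of a pair of vectors in the joint Hilbert sum. -/
def pairFun (x : HS a) (y : HS b) : ∀ i : I ⊕ J, Lp ℂ 2 (Sum.elim a b i)
  | Sum.inl i => x i
  | Sum.inr j => y j

lemma hasSum_pairFun (x : HS a) (y : HS b) :
    HasSum (fun i => ‖pairFun x y i‖ ^ 2) (‖x‖ ^ 2 + ‖y‖ ^ 2) :=
  HasSum.sum (hasSum_norm_sq x) (hasSum_norm_sq y)

/-- The vector of the joint Hilbert sum given by a pair. -/
def pair (x : HS a) (y : HS b) : HS (Sum.elim a b) :=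
  mkHS (pairFun x y) (hasSum_pairFun x y).summable

lemma norm_sq_pair (x : HS a) (y : HS b) : ‖pair x y‖ ^ 2 = ‖x‖ ^ 2 + ‖y‖ ^ 2 :=
  (hasSum_norm_sq (pair x y)).unique (hasSum_pairFun x y)

lemma pair_inl (x : HS a) (y : HS b) (i : I) : (pair x y) (Sum.inl i) = x i := rfl

lemma pair_inr (x : HS a) (y : HS b) (j : J) : (pair x y) (Sum.inr j) = y j := rfl

lemma sum_hs_ext {f g : HS (Sum.elim a b)} (h : ∀ i, f (Sum.inl i) = g (Sum.inl i))
    (h' : ∀ j, f (Sum.inr j) = g (Sum.inr j)) : f = g := by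
  ext1
  funext i
  rcases i with i | j
  · exact h i
  · exact h' j

lemma exists_eq_pair (f : HS (Sum.elim a b)) : ∃ x y, f = pair x y := by
  have hs := (hasSum_norm_sq f).summable
  refine ⟨mkHS (ν := a) (fun i => f (Sum.inl i)) (hs.comp_injective Sum.inl_injective),
    mkHS (ν := b) (fun j => f (Sum.inr j)) (hs.comp_injective Sum.inr_injective),
    sum_hs_ext (fun i => rfl) fun j => rfl⟩

lemma pair_injective {x x' : HS a} {y y' : HS b} (h : pair x y = pair x' y') :
    x = x' ∧ y = y' := by
  constructor
  · ext1; funext i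
    rw [← pair_inl x y, h, pair_inl]
  · ext1; funext j
    rw [← pair_inr x y, h, pair_inr]

lemma pair_add (x x' : HS a) (y y' : HS b) : pair (x + x') (y + y') = pair x y + pair x' y' :=
  sum_hs_ext (fun _ => rfl) fun _ => rfl

lemma pair_smul (c : ℂ) (x : HS a) (y : HS b) : pair (c • x) (c • y) = c • pair x y :=
  sum_hs_ext (fun _ => rfl) fun _ => rfl

variable (a b) in
/-- The inclusion of the first summand. -/
def inlHS : HS a →ₗᵢ[ℂ] HS (Sum.elim a b) where
  toFun x := pair x 0
  map_add' x x' := by rw [← pair_add, add_zero]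
  map_smul' c x := by rw [RingHom.id_apply, ← pair_smul, smul_zero]
  norm_map' x := by
    refine (sq_eq_sq₀ (norm_nonneg _) (norm_nonneg _)).1 ?_
    exact (norm_sq_pair x 0).trans (by simp)

variable (a b) in
/-- The inclusion of the second summand. -/
def inrHS : HS b →ₗᵢ[ℂ] HS (Sum.elim a b) where
  toFun y := pair 0 y
  map_add' x x' := by rw [← pair_add, add_zero]
  map_smul' c x := by rw [RingHom.id_apply, ← pair_smul, smul_zero]
  norm_map' x := by
    refine (sq_eq_sq₀ (norm_nonneg _) (norm_nonneg _)).1 ?_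
    exact (norm_sq_pair 0 x).trans (by simp)

lemma pair_eq_add (x : HS a) (y : HS b) : pair x y = inlHS a b x + inrHS a b y :=
  sum_hs_ext (fun i => (add_zero (x i)).symm) fun j => (zero_add (y j)).symm

/-- The direct sum of two unitaries. -/
lemma exists_sum_isometry (A : HS a ≃ₗᵢ[ℂ] HS a') (B : HS b ≃ₗᵢ[ℂ] HS b') :
    ∃ C : HS (Sum.elim a b) ≃ₗᵢ[ℂ] HS (Sum.elim a' b'), ∀ x y, C (pair x y) = pair (A x) (B y) := by
  choose x y hxy using exists_eq_pair (a := a) (b := b)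
  have hC : ∀ u v, pair (A (x (pair u v))) (B (y (pair u v))) = pair (A u) (B v) := fun u v => by
    obtain ⟨h1, h2⟩ := pair_injective (hxy (pair u v))
    rw [← h1, ← h2]
  let C : HS (Sum.elim a b) →ₗᵢ[ℂ] HS (Sum.elim a' b') :=
    { toFun := fun f => pair (A (x f)) (B (y f))
      map_add' := fun f g => by
        have : f + g = pair (x f + x g) (y f + y g) := by rw [pair_add, ← hxy, ← hxy]
        rw [this, hC, map_add, map_add, pair_add]
      map_smul' := fun c f => by
        have : c • f = pair (c • x f) (c • y f) := by rw [pair_smul, ← hxy]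
        rw [this, hC, map_smul, map_smul, pair_smul, RingHom.id_apply]
      norm_map' := fun f => by
        refine (sq_eq_sq₀ (norm_nonneg _) (norm_nonneg _)).1 ?_
        refine (norm_sq_pair (A (x f)) (B (y f))).trans ?_
        conv_rhs => rw [hxy f, norm_sq_pair]
        simp }
  refine ⟨LinearIsometryEquiv.ofSurjective C fun g => ?_, hC⟩
  obtain ⟨u, v, rfl⟩ := exists_eq_pair g
  refine ⟨pair (A.symm u) (B.symm v), (hC _ _).trans ?_⟩
  simp

lemma symm_pair {A : HS a ≃ₗᵢ[ℂ] HS a'} {B : HS b ≃ₗᵢ[ℂ] HS b'}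
    {C : HS (Sum.elim a b) ≃ₗᵢ[ℂ] HS (Sum.elim a' b')}
    (hC : ∀ x y, C (pair x y) = pair (A x) (B y)) (x : HS a') (y : HS b') :
    C.symm (pair x y) = pair (A.symm x) (B.symm y) := by
  rw [LinearIsometryEquiv.symm_apply_eq, hC]
  simp

end SumSplitting

section Weighted

open scoped ENNReal NNReal

variable {I J : Type*} {q : ℝ} {μ1 : I → Measure ℝ} {ν1 : J → Measure ℝ}

/-- `ι` identifies vectors of `⊕ L²(t⁻¹ dμ₁)` and `⊕ L²(μ₁)` given by the same functions. -/
def IsSameFun (μ1 : I → Measure ℝ) (ι : HS (fun j => wd (μ1 j)) ≃ₗ[ℂ] HS μ1) : Prop :=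
  ∀ g i, ∀ᵐ t ∂μ1 i, ((ι g) i) t = (g i) t

lemma wd_absolutelyContinuous (μ : Measure ℝ) : wd μ ≪ μ := withDensity_absolutelyContinuous _ _

lemma ae_pos_of_supp (hq0 : 0 < q) {μ : Measure ℝ} (hs : μ (Set.Ico q 1)ᶜ = 0) :
    ∀ᵐ t ∂μ, q ≤ t ∧ 0 < t ∧ t < 1 := by
  filter_upwards [show ∀ᵐ t ∂μ, t ∈ Set.Ico q 1 from hs] with t ht
  exact ⟨ht.1, hq0.trans_le ht.1, ht.2⟩

lemma lintegral_wd (μ : Measure ℝ) {g : ℝ → ℝ≥0∞} (hg : Measurable g) :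
    ∫⁻ t, g t ∂wd μ = ∫⁻ t, ENNReal.ofReal t⁻¹ * g t ∂μ := by
  rw [wd, lintegral_withDensity_eq_lintegral_mul _ (by fun_prop) hg]
  rfl

lemma exists_isSameFun (hq0 : 0 < q) (hs : ∀ i, μ1 i (Set.Ico q 1)ᶜ = 0) :
    ∃ ι, IsSameFun μ1 ι := by
  obtain ⟨S, hS, -⟩ := exists_hs_weighted_comp (ν := fun i => wd (μ1 i)) (ν' := μ1)
    (m := fun _ _ => 1) (φ := fun _ t => t) (fun _ => measurable_const) (fun _ => measurable_id) 1
    (fun i g hg => by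
      rw [lintegral_wd _ hg, ENNReal.coe_one, one_pow, one_mul]
      refine lintegral_mono_ae ?_
      filter_upwards [ae_pos_of_supp hq0 (hs i)] with t ht
      rw [enorm_one, one_pow]
      gcongr
      rw [ENNReal.one_le_ofReal]
      exact (one_le_inv₀ ht.2.1).2 ht.2.2.le)
  obtain ⟨T, hT, -⟩ := exists_hs_weighted_comp (ν := μ1) (ν' := fun i => wd (μ1 i))
    (m := fun _ _ => 1) (φ := fun _ t => t) (fun _ => measurable_const) (fun _ => measurable_id)
    (Real.toNNReal (max 1 q⁻¹))
    (fun i g hg => by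
      rw [lintegral_wd _ (by fun_prop), ← lintegral_const_mul _ hg]
      refine lintegral_mono_ae ?_
      filter_upwards [ae_pos_of_supp hq0 (hs i)] with t ht
      rw [enorm_one, one_pow, one_mul]
      gcongr
      change ENNReal.ofReal t⁻¹ ≤ ENNReal.ofReal (max 1 q⁻¹) ^ 2
      rw [← ENNReal.ofReal_pow (by positivity)]
      refine ENNReal.ofReal_le_ofReal ?_
      calc t⁻¹ ≤ q⁻¹ := inv_anti₀ hq0 ht.1
        _ ≤ max 1 q⁻¹ := le_max_right _ _
        _ ≤ max 1 q⁻¹ ^ 2 := le_self_pow₀ (le_max_left _ _) two_ne_zero)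
  have hdens : ∀ i, μ1 i ≪ wd (μ1 i) := fun i => by
    refine withDensity_absolutelyContinuous' (by fun_prop) ?_
    filter_upwards [ae_pos_of_supp hq0 (hs i)] with t ht
    simpa using ht.2.1
  refine ⟨LinearEquiv.ofLinearMap S.toLinearMap T.toLinearMap ?_ ?_, fun g i => ?_⟩
  · refine LinearMap.ext fun f => hs_ext fun i => ?_
    filter_upwards [hS (T f) i, (hdens i).ae_le (hT f i)] with t h1 h2
    refine h1.trans ?_
    rw [one_mul, h2, one_mul]
    rfl
  · refine LinearMap.ext fun f => hs_ext fun i => ?_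
    filter_upwards [hT (S f) i, (wd_absolutelyContinuous _).ae_le (hS f i)] with t h1 h2
    refine h1.trans ?_
    rw [one_mul, h2, one_mul]
    rfl
  · filter_upwards [hS g i] with t ht
    exact ht.trans (one_mul _)

lemma inducedBdryMap_iff {ι : HS (fun j => wd (μ1 j)) ≃ₗ[ℂ] HS μ1}
    {ι' : HS (fun j => wd (ν1 j)) ≃ₗ[ℂ] HS ν1} (hι : IsSameFun μ1 ι) (hι' : IsSameFun ν1 ι')
    {A : HS μ1 ≃ₗᵢ[ℂ] HS ν1} {B : HS (fun j => wd (μ1 j)) ≃ₗᵢ[ℂ] HS (fun j => wd (ν1 j))} :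
    InducedBdryMap μ1 ν1 A B ↔ ∀ g, ι' (B g) = A (ι g) := by
  constructor
  · intro h g
    refine hs_ext fun i => ?_
    filter_upwards [hι' (B g) i, h (ι g) g (fun j => by
      filter_upwards [hι g j] with t ht using ht.symm) i] with t h1 h2
    rw [h1, h2]
  · intro h f g hfg j
    have : f = ι g := hs_ext fun i => by
      filter_upwards [hι g i, hfg i] with t h1 h2
      rw [h1, h2]
    rw [this, ← h]
    filter_upwards [hι' (B g) j] with t ht using ht.symm

lemma inner_self_wd (hq0 : 0 < q) (hs : ∀ i, μ1 i (Set.Ico q 1)ᶜ = 0)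
    {ι : HS (fun j => wd (μ1 j)) ≃ₗ[ℂ] HS μ1} (hι : IsSameFun μ1 ι) {Q : HS μ1 →L[ℂ] HS μ1}
    (hQ : IsMulCLM μ1 Q) {g : HS (fun j => wd (μ1 j))} {m : HS μ1} (hm : Q m = ι g) :
    inner ℂ g g = inner ℂ (ι g) m := by
  rw [lp.inner_eq_tsum, lp.inner_eq_tsum]
  refine tsum_congr fun i => ?_
  rw [L2.inner_def, L2.inner_def]
  change ∫ t, _ ∂((μ1 i).withDensity fun t => ENNReal.ofReal t⁻¹) = _
  rw [integral_withDensity_eq_integral_toReal_smul (by fun_prop)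
    (Filter.Eventually.of_forall fun t => ENNReal.ofReal_lt_top)]
  refine integral_congr_ae ?_
  have h3 := hQ m i
  rw [hm] at h3
  filter_upwards [hι g i, ae_pos_of_supp hq0 (hs i), h3] with t h1 h2 h3
  rw [h3] at h1
  rw [h3, ← h1, ENNReal.toReal_ofReal (inv_pos.2 h2.2.1).le]
  have : (t : ℂ) ≠ 0 := by exact_mod_cast h2.2.1.ne'
  simp only [RCLike.inner_apply, map_mul, Complex.conj_ofReal, Complex.real_smul,
    Complex.ofReal_inv]
  field_simp

lemma mulCLM_surjective (hq0 : 0 < q) (hs : ∀ i, μ1 i (Set.Ico q 1)ᶜ = 0) {Q : HS μ1 →L[ℂ] HS μ1}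
    (hQ : IsMulCLM μ1 Q) : Function.Surjective Q := by
  obtain ⟨T, hT, -⟩ := exists_hs_mul (ν := μ1) (m := fun _ s => ((s⁻¹ : ℝ) : ℂ))
    (fun i => by fun_prop) (Real.toNNReal q⁻¹) (fun i => by
      filter_upwards [ae_pos_of_supp hq0 (hs i)] with s hs
      rw [Complex.norm_real, Real.norm_eq_abs, abs_inv, abs_of_pos hs.2.1,
        Real.coe_toNNReal _ (inv_pos.2 hq0).le]
      exact inv_anti₀ hq0 hs.1)
  refine fun k => ⟨T k, hs_ext fun i => ?_⟩
  filter_upwards [hQ (T k) i, hT k i, ae_pos_of_supp hq0 (hs i)] with s h1 h2 h3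
  rw [h1, h2, ← mul_assoc, ← Complex.ofReal_mul, mul_inv_cancel₀ h3.2.1.ne', Complex.ofReal_one,
    one_mul]

/-- A unitary commuting with the position operators induces a unitary of the weighted spaces. -/
lemma exists_inducedMap (hq0 : 0 < q) (hs : ∀ i, μ1 i (Set.Ico q 1)ᶜ = 0)
    (hs' : ∀ i, ν1 i (Set.Ico q 1)ᶜ = 0)
    {ι : HS (fun j => wd (μ1 j)) ≃ₗ[ℂ] HS μ1} {ι' : HS (fun j => wd (ν1 j)) ≃ₗ[ℂ] HS ν1}
    (hι : IsSameFun μ1 ι) (hι' : IsSameFun ν1 ι') {Q : HS μ1 →L[ℂ] HS μ1}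
    {Q' : HS ν1 →L[ℂ] HS ν1} (hQ : IsMulCLM μ1 Q) (hQ' : IsMulCLM ν1 Q')
    {A : HS μ1 ≃ₗᵢ[ℂ] HS ν1} (hA : ∀ f, A (Q f) = Q' (A f)) :
    ∃ B : HS (fun j => wd (μ1 j)) ≃ₗᵢ[ℂ] HS (fun j => wd (ν1 j)), ∀ g, ι' (B g) = A (ι g) := by
  let B : HS (fun j => wd (μ1 j)) ≃ₗ[ℂ] HS (fun j => wd (ν1 j)) :=
    (ι.trans A.toLinearEquiv).trans ι'.symm
  have hB : ∀ g, ι' (B g) = A (ι g) := fun g => ι'.apply_symm_apply _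
  refine ⟨⟨B, fun g => ?_⟩, hB⟩
  obtain ⟨m, hm⟩ := mulCLM_surjective hq0 hs hQ (ι g)
  have h1 := inner_self_wd hq0 hs hι hQ hm
  have h2 := inner_self_wd (g := B g) (m := A m) hq0 hs' hι' hQ' (by rw [← hA, hm, hB])
  rw [hB, A.inner_map_map, ← h1, inner_self_eq_norm_sq_to_K, inner_self_eq_norm_sq_to_K] at h2
  refine (sq_eq_sq₀ (norm_nonneg _) (norm_nonneg _)).1 ?_
  exact_mod_cast h2

end Weighted

/-- A unitary mapping the range of one isometry onto that of another restricts to a unitary. -/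
lemma exists_restriction {K K' H H' : Type*} [NormedAddCommGroup K] [InnerProductSpace ℂ K]
    [NormedAddCommGroup K'] [InnerProductSpace ℂ K'] [NormedAddCommGroup H]
    [InnerProductSpace ℂ H] [NormedAddCommGroup H'] [InnerProductSpace ℂ H']
    {J : K →ₗᵢ[ℂ] H} {J' : K' →ₗᵢ[ℂ] H'} {Θ : H ≃ₗᵢ[ℂ] H'} (h : ∀ k, ∃ k', J' k' = Θ (J k))
    (h' : ∀ k', ∃ k, J k = Θ.symm (J' k')) :
    ∃ A : K ≃ₗᵢ[ℂ] K', ∀ k, J' (A k) = Θ (J k) := by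
  choose A hA using h
  let A₀ : K →ₗᵢ[ℂ] K' :=
    { toFun := A
      map_add' := fun k l => J'.injective (by simp [hA])
      map_smul' := fun c k => J'.injective (by simp [hA])
      norm_map' := fun k => by
        change ‖A k‖ = _
        rw [← J'.norm_map, hA, Θ.norm_map, J.norm_map] }
  refine ⟨LinearIsometryEquiv.ofSurjective A₀ fun k' => ?_, hA⟩
  obtain ⟨k, hk⟩ := h' k'
  refine ⟨k, J'.injective ((hA k).trans ?_)⟩
  rw [hk, Θ.apply_symm_apply]

section Presentation

variable {Ip Im Jp Jm : Type*} {q : ℝ}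
  {μ1p : Ip → Measure ℝ} {μ1m : Im → Measure ℝ} {ν1p : Jp → Measure ℝ} {ν1m : Jm → Measure ℝ}
  {μp : Ip → Measure ℝ} {μm : Im → Measure ℝ} {νp : Jp → Measure ℝ} {νm : Jm → Measure ℝ}

variable (Ip Im) in
/-- The signs of the half-axes carrying the components. -/
def axisSign : Ip ⊕ Im → ℝ := Sum.elim (fun _ => 1) fun _ => -1

/-- The data of a triple `{P, X_{V,W}, U}`, together with a presentation on which `U` is a
bilateral shift, `P` is diagonal, and the boundary vectors are read off from coefficients. -/
structure IsPresented (q : ℝ)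
    (E : HS (Sum.elim μ1p μ1m) →ₗᵢ[ℂ] HS (Sum.elim μp μm))
    (D : HS (Sum.elim μ1p μ1m) →L[ℂ] HS (Sum.elim μ1p μ1m))
    (ιp : HS (fun j => wd (μ1p j)) ≃ₗ[ℂ] HS μ1p) (ιm : HS (fun j => wd (μ1m j)) ≃ₗ[ℂ] HS μ1m)
    (U : HS (Sum.elim μp μm) ≃ₗᵢ[ℂ] HS (Sum.elim μp μm))
    (P X Y : HS (Sum.elim μp μm) →ₗ.[ℂ] HS (Sum.elim μp μm))
    (V W : HS (fun j => wd (μ1m j)) ≃ₗᵢ[ℂ] HS (fun j => wd (μ1p j)))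
    (Pp : HS μ1p →L[ℂ] HS μ1p) (Pm : HS μ1m →L[ℂ] HS μ1m) : Prop where
  model : IsModel q (axisSign Ip Im) (Sum.elim μ1p μ1m) (Sum.elim μp μm) E U
  signMul : IsSignMul (axisSign Ip Im) (Sum.elim μ1p μ1m) D
  same_pos : IsSameFun μ1p ιp
  same_neg : IsSameFun μ1m ιm
  isPop : IsPop (Sum.elim μp μm) P
  isXop : IsXop q (Sum.elim μp μm) X
  supp_pos : ∀ j, μ1p j (Set.Ico q 1)ᶜ = 0
  supp_neg : ∀ j, μ1m j (Set.Ico q 1)ᶜ = 0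
  mul_pos : IsMulCLM μ1p Pp
  mul_neg : IsMulCLM μ1m Pm
  le_adjoint : Y ≤ X.adjoint
  mem_domain : ∀ f, f ∈ Y.domain ↔ MemXVW q μp μm μ1p μ1m X V W f

lemma exists_isPresented (hq0 : 0 < q) (hq1 : q < 1)
    (hsp : ∀ j, μ1p j (Set.Ico q 1)ᶜ = 0) (hsm : ∀ j, μ1m j (Set.Ico q 1)ᶜ = 0)
    (hp : ∀ j, IsInducedPlus q (μ1p j) (μp j)) (hm : ∀ j, IsInducedMinus q (μ1m j) (μm j))
    {U : HS (Sum.elim μp μm) ≃ₗᵢ[ℂ] HS (Sum.elim μp μm)} (hU : IsUop q (Sum.elim μp μm) U)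
    {P X Y : HS (Sum.elim μp μm) →ₗ.[ℂ] HS (Sum.elim μp μm)}
    (hP : IsPop (Sum.elim μp μm) P) (hX : IsXop q (Sum.elim μp μm) X)
    {V W : HS (fun j => wd (μ1m j)) ≃ₗᵢ[ℂ] HS (fun j => wd (μ1p j))} (hYle : Y ≤ X.adjoint)
    (hYdom : ∀ f, f ∈ Y.domain ↔ MemXVW q μp μm μ1p μ1m X V W f)
    {Pp : HS μ1p →L[ℂ] HS μ1p} (hPp : IsMulCLM μ1p Pp)
    {Pm : HS μ1m →L[ℂ] HS μ1m} (hPm : IsMulCLM μ1m Pm) :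
    ∃ E D ιp ιm, IsPresented q E D ιp ιm U P X Y V W Pp Pm := by
  have hind : ∀ i, IsInduced q (axisSign Ip Im i) (Sum.elim μ1p μ1m i) (Sum.elim μp μm i) := by
    rintro (j | j)
    · exact (hp j).isInduced hq0 hq1 (hsp j)
    · exact (hm j).isInduced hq0 hq1 (hsm j)
  obtain ⟨E, hE⟩ := exists_isModel hq0 hq1 hind hU
  obtain ⟨D, hD⟩ := hE.exists_isSignMul
  obtain ⟨ιp, hιp⟩ := exists_isSameFun hq0 hsp
  obtain ⟨ιm, hιm⟩ := exists_isSameFun hq0 hsm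
  exact ⟨E, D, ιp, ιm, hE, hD, hιp, hιm, hP, hX, hsp, hsm, hPp, hPm, hYle, hYdom⟩

namespace IsPresented

variable {E : HS (Sum.elim μ1p μ1m) →ₗᵢ[ℂ] HS (Sum.elim μp μm)}
  {D : HS (Sum.elim μ1p μ1m) →L[ℂ] HS (Sum.elim μ1p μ1m)}
  {ιp : HS (fun j => wd (μ1p j)) ≃ₗ[ℂ] HS μ1p} {ιm : HS (fun j => wd (μ1m j)) ≃ₗ[ℂ] HS μ1m}
  {U : HS (Sum.elim μp μm) ≃ₗᵢ[ℂ] HS (Sum.elim μp μm)}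
  {P X Y : HS (Sum.elim μp μm) →ₗ.[ℂ] HS (Sum.elim μp μm)}
  {V W : HS (fun j => wd (μ1m j)) ≃ₗᵢ[ℂ] HS (fun j => wd (μ1p j))}
  {Pp : HS μ1p →L[ℂ] HS μ1p} {Pm : HS μ1m →L[ℂ] HS μ1m}
  {E' : HS (Sum.elim ν1p ν1m) →ₗᵢ[ℂ] HS (Sum.elim νp νm)}
  {D' : HS (Sum.elim ν1p ν1m) →L[ℂ] HS (Sum.elim ν1p ν1m)}
  {κp : HS (fun j => wd (ν1p j)) ≃ₗ[ℂ] HS ν1p} {κm : HS (fun j => wd (ν1m j)) ≃ₗ[ℂ] HS ν1m}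
  {U' : HS (Sum.elim νp νm) ≃ₗᵢ[ℂ] HS (Sum.elim νp νm)}
  {P' X' Y' : HS (Sum.elim νp νm) →ₗ.[ℂ] HS (Sum.elim νp νm)}
  {V' W' : HS (fun j => wd (ν1m j)) ≃ₗᵢ[ℂ] HS (fun j => wd (ν1p j))}
  {Pp' : HS ν1p →L[ℂ] HS ν1p} {Pm' : HS ν1m →L[ℂ] HS ν1m}

lemma isBdry_iff (h : IsPresented q E D ιp ιm U P X Y V W Pp Pm) {f be bo ce co} :
    IsBdry q μp μm μ1p μ1m X f be bo ce co ↔ f ∈ X.adjoint.domain ∧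
      HasBdry ((√q : ℝ) : ℂ) E U X f (pair (ιp be) (ιm ce)) (pair (ιp bo) (ιm co)) := by
  rw [← h.model.hasBdry_iff (b := Sum.elim (fun j => ⇑(be j)) fun j => ⇑(ce j))
    (c := Sum.elim (fun j => ⇑(bo j)) fun j => ⇑(co j)), IsBdry]
  · simp only [Sum.forall, axisSign, Sum.elim_inl, Sum.elim_inr, IsAltExt, IsEvenExt, IsOddExt,
      IsEvenExtNeg, IsOddExtNeg, one_mul, neg_one_mul, add_zero]
  · rintro (j | j)
    · filter_upwards [h.same_pos be j] with t ht using ht.symm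
    · filter_upwards [h.same_neg ce j] with t ht using ht.symm
  · rintro (j | j)
    · filter_upwards [h.same_pos bo j] with t ht using ht.symm
    · filter_upwards [h.same_neg co j] with t ht using ht.symm

lemma diag_pair (h : IsPresented q E D ιp ιm U P X Y V W Pp Pm) (x : HS μ1p) (y : HS μ1m) :
    D (pair x y) = pair (Pp x) (-(Pm y)) := by
  refine hs_ext ?_
  rintro (j | j)
  · filter_upwards [h.signMul (pair x y) (Sum.inl j), h.mul_pos x j] with t h1 h2
    rw [h1]
    refine Eq.trans ?_ h2.symm
    simp [axisSign, pair_inl]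
  · rw [← neg_one_smul ℂ (Pm y)]
    filter_upwards [h.signMul (pair x y) (Sum.inr j), h.mul_neg y j,
      hs_coeFn_smul (-1) (Pm y) j] with t h1 h2 h3
    rw [h1]
    refine Eq.trans ?_ h3.symm
    rw [h2]
    simp [axisSign, pair_inr]

lemma sqrt_pos (h : IsPresented q E D ιp ιm U P X Y V W Pp Pm) : 0 < √q :=
  Real.sqrt_pos.2 h.model.pos

lemma sqrt_lt_one (h : IsPresented q E D ιp ιm U P X Y V W Pp Pm) : √q < 1 := by
  rw [Real.sqrt_lt' one_pos, one_pow]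
  exact h.model.lt_one

lemma carries_X (h : IsPresented q E D ιp ιm U P X Y V W Pp Pm)
    (h' : IsPresented q E' D' κp κm U' P' X' Y' V' W' Pp' Pm')
    {Θ : HS (Sum.elim μp μm) ≃ₗᵢ[ℂ] HS (Sum.elim νp νm)}
    {C : HS (Sum.elim μ1p μ1m) ≃ₗᵢ[ℂ] HS (Sum.elim ν1p ν1m)}
    (hΘ : ∀ n f, coef E' U' n (Θ f) = C (coef E U n f)) (hC : ∀ k, C (D k) = D' (C k)) :
    Carries Θ X X' :=
  (h.model.isShiftDiff h.signMul h.isXop).carries (h'.model.isShiftDiff h'.signMul h'.isXop)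
    h'.model.wandering (h'.model.signMul_injective h'.signMul) hΘ hC

lemma carries_Y (h : IsPresented q E D ιp ιm U P X Y V W Pp Pm)
    (h' : IsPresented q E' D' κp κm U' P' X' Y' V' W' Pp' Pm')
    {Θ : HS (Sum.elim μp μm) ≃ₗᵢ[ℂ] HS (Sum.elim νp νm)}
    {C : HS (Sum.elim μ1p μ1m) ≃ₗᵢ[ℂ] HS (Sum.elim ν1p ν1m)}
    (hΘ : ∀ n f, coef E' U' n (Θ f) = C (coef E U n f))
    (hX : Carries Θ X X') (hX' : Carries Θ.symm X' X)
    {Ap : HS μ1p ≃ₗᵢ[ℂ] HS ν1p} {Am : HS μ1m ≃ₗᵢ[ℂ] HS ν1m}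
    (hC : ∀ x y, C (pair x y) = pair (Ap x) (Am y))
    {Bp : HS (fun j => wd (μ1p j)) ≃ₗᵢ[ℂ] HS (fun j => wd (ν1p j))}
    {Bm : HS (fun j => wd (μ1m j)) ≃ₗᵢ[ℂ] HS (fun j => wd (ν1m j))}
    (hBp : ∀ g, κp (Bp g) = Ap (ιp g)) (hBm : ∀ g, κm (Bm g) = Am (ιm g))
    (hV : ∀ g, Bp (V g) = V' (Bm g)) (hW : ∀ g, Bp (W g) = W' (Bm g)) :
    Carries Θ Y Y' := by
  intro f
  have hadj := hX.adjoint hX'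
  have hmem : Θ f ∈ Y'.domain := by
    obtain ⟨be, bo, ce, co, hb, h1, h2⟩ := (h.mem_domain f).1 f.2
    rw [h.isBdry_iff] at hb
    refine (h'.mem_domain _).2 ⟨Bp be, Bp bo, Bm ce, Bm co, h'.isBdry_iff.2
      ⟨(hadj ⟨_, hb.1⟩).1, ?_⟩, ?_, ?_⟩
    · rw [hBp, hBp, hBm, hBm, ← hC, ← hC]
      exact hb.2.map hX hΘ
    · rw [← map_add, ← map_add, ← hV, h1]
    · rw [← map_sub, ← map_sub, ← hW, h2]
  refine ⟨hmem, ?_⟩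
  have hf : (f : HS (Sum.elim μp μm)) ∈ X.adjoint.domain := h.le_adjoint.1 f.2
  obtain ⟨h1, h2⟩ := hadj ⟨_, hf⟩
  rw [h.le_adjoint.2 (x := f) (y := ⟨_, hf⟩) rfl, ← h2]
  exact h'.le_adjoint.2 rfl

lemma exists_boundary (h : IsPresented q E D ιp ιm U P X Y V W Pp Pm) (be bo ce co)
    (h1 : be + bo = V (ce + co)) (h2 : be - bo = W (ce - co)) :
    ∃ f ∈ Y.domain,
      HasBdry ((√q : ℝ) : ℂ) E U X f (pair (ιp be) (ιm ce)) (pair (ιp bo) (ιm co)) := by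
  obtain ⟨f, hf, hb⟩ := h.model.wandering.exists_hasBdry h.sqrt_pos h.sqrt_lt_one
    (h.model.isShiftDiff h.signMul h.isXop) (IsModel.signMul_inner h.signMul)
    (h.model.signMul_surjective h.signMul) (pair (ιp be) (ιm ce)) (pair (ιp bo) (ιm co))
  exact ⟨f, (h.mem_domain f).2 ⟨be, bo, ce, co, h.isBdry_iff.2 ⟨hf, hb⟩, h1, h2⟩, hb⟩

/-- A unitary carrying `Y` to `Y'` maps boundary vectors satisfying the boundary conditions of `Y`
to ones satisfying those of `Y'`. -/
lemma boundary_of_carries_Y (h : IsPresented q E D ιp ιm U P X Y V W Pp Pm)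
    (h' : IsPresented q E' D' κp κm U' P' X' Y' V' W' Pp' Pm')
    {Θ : HS (Sum.elim μp μm) ≃ₗᵢ[ℂ] HS (Sum.elim νp νm)}
    {C : HS (Sum.elim μ1p μ1m) ≃ₗᵢ[ℂ] HS (Sum.elim ν1p ν1m)}
    (hΘ : ∀ n f, coef E' U' n (Θ f) = C (coef E U n f))
    (hX : Carries Θ X X') (hY : Carries Θ Y Y')
    {Ap : HS μ1p ≃ₗᵢ[ℂ] HS ν1p} {Am : HS μ1m ≃ₗᵢ[ℂ] HS ν1m}
    (hC : ∀ x y, C (pair x y) = pair (Ap x) (Am y))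
    {Bp : HS (fun j => wd (μ1p j)) ≃ₗᵢ[ℂ] HS (fun j => wd (ν1p j))}
    {Bm : HS (fun j => wd (μ1m j)) ≃ₗᵢ[ℂ] HS (fun j => wd (ν1m j))}
    (hBp : ∀ g, κp (Bp g) = Ap (ιp g)) (hBm : ∀ g, κm (Bm g) = Am (ιm g)) {be bo ce co}
    (h1 : be + bo = V (ce + co)) (h2 : be - bo = W (ce - co)) :
    Bp (be + bo) = V' (Bm (ce + co)) ∧ Bp (be - bo) = W' (Bm (ce - co)) := by
  obtain ⟨f, hf, hb⟩ := h.exists_boundary be bo ce co h1 h2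
  obtain ⟨be', bo', ce', co', hb', h1', h2'⟩ := (h'.mem_domain _).1 (hY ⟨f, hf⟩).1
  obtain ⟨he, ho⟩ := HasBdry.unique h'.sqrt_pos h'.sqrt_lt_one
    (h'.model.isShiftDiff h'.signMul h'.isXop) (hb.map hX hΘ) (h'.isBdry_iff.1 hb').2
  rw [hC, ← hBp, ← hBm] at he ho
  have e1 := κp.injective (pair_injective he).1
  have e2 := κm.injective (pair_injective he).2
  have e3 := κp.injective (pair_injective ho).1
  have e4 := κm.injective (pair_injective ho).2
  constructor
  · rw [map_add, map_add, e1, e2, e3, e4, h1']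
  · rw [map_sub, map_sub, e1, e2, e3, e4, h2']

lemma exists_unitary (h : IsPresented q E D ιp ιm U P X Y V W Pp Pm)
    (h' : IsPresented q E' D' κp κm U' P' X' Y' V' W' Pp' Pm')
    {Ap : HS μ1p ≃ₗᵢ[ℂ] HS ν1p} {Am : HS μ1m ≃ₗᵢ[ℂ] HS ν1m}
    (hAp : ∀ f, Ap (Pp f) = Pp' (Ap f)) (hAm : ∀ f, Am (Pm f) = Pm' (Am f))
    {Bp : HS (fun j => wd (μ1p j)) ≃ₗᵢ[ℂ] HS (fun j => wd (ν1p j))}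
    {Bm : HS (fun j => wd (μ1m j)) ≃ₗᵢ[ℂ] HS (fun j => wd (ν1m j))}
    (hBp : ∀ g, κp (Bp g) = Ap (ιp g)) (hBm : ∀ g, κm (Bm g) = Am (ιm g))
    (hV : ∀ g, Bp (V g) = V' (Bm g)) (hW : ∀ g, Bp (W g) = W' (Bm g)) :
    ∃ Θ : HS (Sum.elim μp μm) ≃ₗᵢ[ℂ] HS (Sum.elim νp νm),
      TransportsPMap Θ P P' ∧ TransportsPMap Θ Y Y' ∧ ∀ f, Θ (U f) = U' (Θ f) := by
  obtain ⟨C, hC⟩ := exists_sum_isometry Ap Am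
  have hCs := symm_pair hC
  obtain ⟨Θ, hΘ⟩ := h.model.wandering.exists_extension h'.model.wandering C
  have hΘs : ∀ n f, coef E U n (Θ.symm f) = C.symm (coef E' U' n f) := fun n f => by
    rw [LinearIsometryEquiv.eq_symm_apply, ← hΘ, Θ.apply_symm_apply]
  have hCD : ∀ k, C (D k) = D' (C k) := fun k => by
    obtain ⟨x, y, rfl⟩ := exists_eq_pair k
    rw [h.diag_pair, hC, hC, h'.diag_pair, map_neg, hAp, hAm]
  have hCDs : ∀ k, C.symm (D' k) = D (C.symm k) := fun k => by
    rw [LinearIsometryEquiv.symm_apply_eq, hCD, C.apply_symm_apply]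
  have hPd := h.model.isDiag h.signMul h.isPop
  have hPd' := h'.model.isDiag h'.signMul h'.isPop
  have hX := h.carries_X h' hΘ hCD
  have hXs := h'.carries_X h hΘs hCDs
  have hBps : ∀ g, ιp (Bp.symm g) = Ap.symm (κp g) := fun g => by
    rw [LinearIsometryEquiv.eq_symm_apply, ← hBp, Bp.apply_symm_apply]
  have hBms : ∀ g, ιm (Bm.symm g) = Am.symm (κm g) := fun g => by
    rw [LinearIsometryEquiv.eq_symm_apply, ← hBm, Bm.apply_symm_apply]
  refine ⟨Θ, ⟨hPd.carries hPd' h'.model.wandering hΘ hCD, fun g =>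
    (hPd'.carries hPd h.model.wandering hΘs hCDs g).1⟩,
    ⟨h.carries_Y h' hΘ hX hXs hC hBp hBm hV hW, fun g =>
      (h'.carries_Y h hΘs hXs (by simpa using hX) hCs hBps hBms ?_ ?_ g).1⟩,
    h'.model.wandering.comm_of_coef hΘ⟩
  · intro g
    rw [LinearIsometryEquiv.symm_apply_eq, hV, Bm.apply_symm_apply]
  · intro g
    rw [LinearIsometryEquiv.symm_apply_eq, hW, Bm.apply_symm_apply]

/-- Unitaries carrying `P` to `P'` and `U` to `U'` restrict to the embedded half-axis parts. -/
lemma exists_restriction_pos (h : IsPresented q E D ιp ιm U P X Y V W Pp Pm)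
    (h' : IsPresented q E' D' κp κm U' P' X' Y' V' W' Pp' Pm')
    {Θ : HS (Sum.elim μp μm) ≃ₗᵢ[ℂ] HS (Sum.elim νp νm)}
    (hP : Carries Θ P P') (hPs : Carries Θ.symm P' P) (x : HS μ1p) :
    ∃ x' : HS ν1p, E' (inlHS ν1p ν1m x') = Θ (E (inlHS μ1p μ1m x)) := by
  obtain ⟨k', hk', he⟩ := h.model.exists_map_embed h'.model h.isPop h'.isPop hP hPs (.inl rfl)
    (k := inlHS μ1p μ1m x) (by
      rintro (j | j) hj
      · exact absurd rfl hj
      · rfl)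
  obtain ⟨x', y', rfl⟩ := exists_eq_pair k'
  refine ⟨x', he ▸ congrArg E' (sum_hs_ext (fun _ => rfl) fun j => ?_)⟩
  exact (hk' (Sum.inr j) (by norm_num [axisSign])).symm

lemma exists_restriction_neg (h : IsPresented q E D ιp ιm U P X Y V W Pp Pm)
    (h' : IsPresented q E' D' κp κm U' P' X' Y' V' W' Pp' Pm')
    {Θ : HS (Sum.elim μp μm) ≃ₗᵢ[ℂ] HS (Sum.elim νp νm)}
    (hP : Carries Θ P P') (hPs : Carries Θ.symm P' P) (y : HS μ1m) :
    ∃ y' : HS ν1m, E' (inrHS ν1p ν1m y') = Θ (E (inrHS μ1p μ1m y)) := by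
  obtain ⟨k', hk', he⟩ := h.model.exists_map_embed h'.model h.isPop h'.isPop hP hPs (.inr rfl)
    (k := inrHS μ1p μ1m y) (by
      rintro (j | j) hj
      · rfl
      · exact absurd rfl hj)
  obtain ⟨x', y', rfl⟩ := exists_eq_pair k'
  refine ⟨y', he ▸ congrArg E' (sum_hs_ext (fun j => ?_) fun _ => rfl)⟩
  exact (hk' (Sum.inl j) (by norm_num [axisSign])).symm

lemma exists_components (h : IsPresented q E D ιp ιm U P X Y V W Pp Pm)
    (h' : IsPresented q E' D' κp κm U' P' X' Y' V' W' Pp' Pm')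
    {Θ : HS (Sum.elim μp μm) ≃ₗᵢ[ℂ] HS (Sum.elim νp νm)}
    (hP : TransportsPMap Θ P P') (hY : TransportsPMap Θ Y Y') (hU : ∀ f, Θ (U f) = U' (Θ f)) :
    ∃ (Ap : HS μ1p ≃ₗᵢ[ℂ] HS ν1p) (Am : HS μ1m ≃ₗᵢ[ℂ] HS ν1m),
      (∀ f, Ap (Pp f) = Pp' (Ap f)) ∧ (∀ f, Am (Pm f) = Pm' (Am f)) ∧
      ∃ (Bp : HS (fun j => wd (μ1p j)) ≃ₗᵢ[ℂ] HS (fun j => wd (ν1p j)))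
        (Bm : HS (fun j => wd (μ1m j)) ≃ₗᵢ[ℂ] HS (fun j => wd (ν1m j))),
        (∀ g, κp (Bp g) = Ap (ιp g)) ∧ (∀ g, κm (Bm g) = Am (ιm g)) ∧
        (∀ g, Bp (V g) = V' (Bm g)) ∧ (∀ g, Bp (W g) = W' (Bm g)) := by
  have hPs : Carries Θ.symm P' P := fun g => by
    refine ⟨hP.2 g, ?_⟩
    obtain ⟨h1, h2⟩ := hP.1 ⟨_, hP.2 g⟩
    rw [LinearIsometryEquiv.eq_symm_apply, ← h2]
    congr 1
    exact Subtype.ext (Θ.apply_symm_apply _)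
  have hPss : Carries Θ.symm.symm P P' := hP.1
  obtain ⟨Ap, hAp⟩ := exists_restriction (J := E.comp (inlHS μ1p μ1m))
    (J' := E'.comp (inlHS ν1p ν1m)) (h.exists_restriction_pos h' hP.1 hPs)
    (h'.exists_restriction_pos h hPs hPss)
  obtain ⟨Am, hAm⟩ := exists_restriction (J := E.comp (inrHS μ1p μ1m))
    (J' := E'.comp (inrHS ν1p ν1m)) (h.exists_restriction_neg h' hP.1 hPs)
    (h'.exists_restriction_neg h hPs hPss)
  obtain ⟨C, hC⟩ := exists_sum_isometry Ap Am
  have hE : ∀ k, Θ (E k) = E' (C k) := fun k => by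
    obtain ⟨x, y, rfl⟩ := exists_eq_pair k
    rw [hC, pair_eq_add, pair_eq_add, map_add, map_add, map_add]
    exact congrArg₂ (· + ·) (hAp x).symm (hAm y).symm
  have hΘ := coef_of_comm Θ C hU hE
  have hPd := h.model.isDiag h.signMul h.isPop
  have hPd' := h'.model.isDiag h'.signMul h'.isPop
  have hCD : ∀ k, C (D k) = D' (C k) := fun k => by
    have hk : E k ∈ P.domain := (hPd.1 _).2 ⟨E (D k), fun n => by
      rw [h.model.wandering.coef_embed, h.model.wandering.coef_embed]
      split_ifs with hn
      · simp [hn]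
      · simp⟩
    obtain ⟨h1, h2⟩ := hP.1 ⟨_, hk⟩
    have e1 := hPd.2 ⟨_, hk⟩ 0
    have e2 := hPd'.2 ⟨_, h1⟩ 0
    rw [h2, hΘ, e1] at e2
    simpa [hΘ, h.model.wandering.coef_embed] using e2
  have hD : ∀ x y, Ap (Pp x) = Pp' (Ap x) ∧ -Am (Pm y) = -Pm' (Am y) := fun x y => by
    have := hCD (pair x y)
    rw [h.diag_pair, hC, hC, h'.diag_pair, map_neg] at this
    exact pair_injective this
  have hDp : ∀ x, Ap (Pp x) = Pp' (Ap x) := fun x => (hD x 0).1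
  have hDm : ∀ y, Am (Pm y) = Pm' (Am y) := fun y => neg_injective (hD 0 y).2
  obtain ⟨Bp, hBp⟩ := exists_inducedMap h.model.pos h.supp_pos h'.supp_pos h.same_pos h'.same_pos
    h.mul_pos h'.mul_pos hDp
  obtain ⟨Bm, hBm⟩ := exists_inducedMap h.model.pos h.supp_neg h'.supp_neg h.same_neg h'.same_neg
    h.mul_neg h'.mul_neg hDm
  refine ⟨Ap, Am, hDp, hDm, Bp, Bm, hBp, hBm, fun g => ?_, fun g => ?_⟩
  · have := (h.boundary_of_carries_Y h' hΘ (h.carries_X h' hΘ hCD) hY.1 hC hBp hBm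
      (be := (2⁻¹ : ℂ) • V g) (bo := (2⁻¹ : ℂ) • V g) (ce := (2⁻¹ : ℂ) • g)
      (co := (2⁻¹ : ℂ) • g) (by simp) (by simp)).1
    rw [← add_smul, ← add_smul] at this
    norm_num at this
    exact this
  · have := (h.boundary_of_carries_Y h' hΘ (h.carries_X h' hΘ hCD) hY.1 hC hBp hBm
      (be := (2⁻¹ : ℂ) • W g) (bo := -((2⁻¹ : ℂ) • W g)) (ce := (2⁻¹ : ℂ) • g)
      (co := -((2⁻¹ : ℂ) • g)) (by simp) (by simp)).2
    rw [sub_neg_eq_add, sub_neg_eq_add, ← add_smul, ← add_smul] at this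
    norm_num at this
    exact this

end IsPresented

end Presentation

/-- **Proposition 5.** Two triples `{P, X_{V,W}, U}` and
`{P̃, X̃_{Ṽ,W̃}, Ũ}` are unitarily equivalent iff there are unitaries `A₊ : K₊ → K̃₊`
and `A₋ : K₋ → K̃₋` with `A₊P₊ = P̃₊A₊`, `A₋P₋ = P̃₋A₋`, `A₊V = ṼA₋` and `A₊W = W̃A₋`
(the last two via the maps `𝕳₊ → 𝕳̃₊`, `𝕳₋ → 𝕳̃₋` induced by `A₊` and `A₋`). -/
theorem stmt_14 (q : ℝ) (hq0 : 0 < q) (hq1 : q < 1)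
    {Ip Im Jp Jm : Type}
    (μ1p : Ip → Measure ℝ) (μ1m : Im → Measure ℝ)
    (ν1p : Jp → Measure ℝ) (ν1m : Jm → Measure ℝ)
    [∀ j, IsFiniteMeasure (μ1p j)] [∀ j, IsFiniteMeasure (μ1m j)]
    [∀ j, IsFiniteMeasure (ν1p j)] [∀ j, IsFiniteMeasure (ν1m j)]
    (hsp : ∀ j, μ1p j (Set.Ico q 1)ᶜ = 0) (hsm : ∀ j, μ1m j (Set.Ico q 1)ᶜ = 0)
    (hsp' : ∀ j, ν1p j (Set.Ico q 1)ᶜ = 0) (hsm' : ∀ j, ν1m j (Set.Ico q 1)ᶜ = 0)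
    (μp : Ip → Measure ℝ) (μm : Im → Measure ℝ)
    (νp : Jp → Measure ℝ) (νm : Jm → Measure ℝ)
    (hp : ∀ j, IsInducedPlus q (μ1p j) (μp j))
    (hm : ∀ j, IsInducedMinus q (μ1m j) (μm j))
    (hp' : ∀ j, IsInducedPlus q (ν1p j) (νp j))
    (hm' : ∀ j, IsInducedMinus q (ν1m j) (νm j))
    (U : HS (Sum.elim μp μm) ≃ₗᵢ[ℂ] HS (Sum.elim μp μm))
    (hU : IsUop q (Sum.elim μp μm) U)
    (Ut : HS (Sum.elim νp νm) ≃ₗᵢ[ℂ] HS (Sum.elim νp νm))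
    (hUt : IsUop q (Sum.elim νp νm) Ut)
    (P : HS (Sum.elim μp μm) →ₗ.[ℂ] HS (Sum.elim μp μm))
    (hP : IsPop (Sum.elim μp μm) P)
    (Pt : HS (Sum.elim νp νm) →ₗ.[ℂ] HS (Sum.elim νp νm))
    (hPt : IsPop (Sum.elim νp νm) Pt)
    (X : HS (Sum.elim μp μm) →ₗ.[ℂ] HS (Sum.elim μp μm))
    (hX : IsXop q (Sum.elim μp μm) X)
    (Xt : HS (Sum.elim νp νm) →ₗ.[ℂ] HS (Sum.elim νp νm))
    (hXt : IsXop q (Sum.elim νp νm) Xt)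
    (V W : HS (fun j => wd (μ1m j)) ≃ₗᵢ[ℂ] HS (fun j => wd (μ1p j)))
    (Vt Wt : HS (fun j => wd (ν1m j)) ≃ₗᵢ[ℂ] HS (fun j => wd (ν1p j)))
    (Y : HS (Sum.elim μp μm) →ₗ.[ℂ] HS (Sum.elim μp μm))
    (hYle : Y ≤ X.adjoint)
    (hYdom : ∀ f, f ∈ Y.domain ↔ MemXVW q μp μm μ1p μ1m X V W f)
    (Yt : HS (Sum.elim νp νm) →ₗ.[ℂ] HS (Sum.elim νp νm))
    (hYtle : Yt ≤ Xt.adjoint)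
    (hYtdom : ∀ f, f ∈ Yt.domain ↔ MemXVW q νp νm ν1p ν1m Xt Vt Wt f)
    (Pp : HS μ1p →L[ℂ] HS μ1p) (hPp : IsMulCLM μ1p Pp)
    (Pm : HS μ1m →L[ℂ] HS μ1m) (hPm : IsMulCLM μ1m Pm)
    (Ppt : HS ν1p →L[ℂ] HS ν1p) (hPpt : IsMulCLM ν1p Ppt)
    (Pmt : HS ν1m →L[ℂ] HS ν1m) (hPmt : IsMulCLM ν1m Pmt) :
    (∃ Θ : HS (Sum.elim μp μm) ≃ₗᵢ[ℂ] HS (Sum.elim νp νm),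
      TransportsPMap Θ P Pt ∧ TransportsPMap Θ Y Yt ∧
      ∀ f, Θ (U f) = Ut (Θ f)) ↔
    (∃ (Ap : HS μ1p ≃ₗᵢ[ℂ] HS ν1p) (Am : HS μ1m ≃ₗᵢ[ℂ] HS ν1m),
      (∀ f, Ap (Pp f) = Ppt (Ap f)) ∧ (∀ f, Am (Pm f) = Pmt (Am f)) ∧
      ∃ (Bp : HS (fun j => wd (μ1p j)) ≃ₗᵢ[ℂ] HS (fun j => wd (ν1p j)))
        (Bm : HS (fun j => wd (μ1m j)) ≃ₗᵢ[ℂ] HS (fun j => wd (ν1m j))),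
        InducedBdryMap μ1p ν1p Ap Bp ∧ InducedBdryMap μ1m ν1m Am Bm ∧
        (∀ g, Bp (V g) = Vt (Bm g)) ∧ (∀ g, Bp (W g) = Wt (Bm g))) := by
  obtain ⟨E, D, ιp, ιm, h⟩ := exists_isPresented hq0 hq1 hsp hsm hp hm hU hP hX hYle hYdom hPp hPm
  obtain ⟨E', D', κp, κm, h'⟩ :=
    exists_isPresented hq0 hq1 hsp' hsm' hp' hm' hUt hPt hXt hYtle hYtdom hPpt hPmt
  simp only [inducedBdryMap_iff h.same_pos h'.same_pos, inducedBdryMap_iff h.same_neg h'.same_neg]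
  constructor
  · rintro ⟨Θ, hP, hY, hU⟩
    exact h.exists_components h' hP hY hU
  · rintro ⟨Ap, Am, hAp, hAm, Bp, Bm, hBp, hBm, hV, hW⟩
    exact h.exists_unitary h' hAp hAm hBp hBm hV hW

end
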